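/- arXiv:2309.05547 — 2 statements merged into one kernel-verified Lean document; each statement's English description precedes it below -/
import Mathlib

section
/- The group Q_{4,2} is presented by the generators x, y and the relations y³ = 1, x_i⁴ = 1 for every integer i ≥ 0, and [x_i², yxy] = 1 for every integer i ≥ 0. Precisely, the homomorphism from the free group on two generators x, y onto Q_{4,2} sending x ↦ p(X) and y ↦ p(Y) is surjective and its kernel equals the normal closure of the set of relators {y³} ∪ {x_i⁴ : i ≥ 0} ∪ {[x_i², yxy] : i ≥ 0}. -/
/-!
Common setup: the commutator convention `[a,b] = a⁻¹b⁻¹ab` of the paper, the sequence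
`x₀ = x`, `x_{i+1} = [yxy, x_i]`, the Laurent polynomial ring `R = 𝔽₂[t,t⁻¹]`, and the
images `X`, `Y` of `σ₁σ₂σ₃` and `σ₁σ₂σ₃σ₁` in `GL(3, R)` under the mod-2 reduced Burau
representation of the 4-strand braid group.
-/

open Matrix LaurentPolynomial

noncomputable section

set_option maxRecDepth 100000

/-- The paper's commutator convention: `[a,b] = a⁻¹b⁻¹ab`. -/
def br {G : Type*} [Group G] (a b : G) : G := a⁻¹ * b⁻¹ * a * b

/-- The recursively defined elements `x₀ = x`, `x_{i+1} = [yxy, x_i]`. -/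
def xseq {G : Type*} [Group G] (x y : G) : ℕ → G
  | 0 => x
  | n + 1 => br (y * x * y) (xseq x y n)

/-- `R = 𝔽₂[t,t⁻¹]`, the ring of Laurent polynomials over the field with two elements. -/
abbrev R2 : Type := LaurentPolynomial (ZMod 2)

instance : CharP R2 2 := charP_of_injective_algebraMap (algebraMap (ZMod 2) R2).injective 2

/-- The matrix `X = t·!![0,0,1; 1,0,1; 0,1,1]`. -/
def Xmat : Matrix (Fin 3) (Fin 3) R2 := (T 1 : R2) • !![0,0,1; 1,0,1; 0,1,1]

/-- The matrix `Y = t·!![0,0,1; t,1,1; 0,1,1]`. -/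
def Ymat : Matrix (Fin 3) (Fin 3) R2 := (T 1 : R2) • !![0,0,1; T 1,1,1; 0,1,1]

/-- An explicit inverse for `Xmat`. -/
def Xmatinv : Matrix (Fin 3) (Fin 3) R2 := (T (-1) : R2) • !![1,1,0; 1,0,1; 1,0,0]

/-- An explicit inverse for `Ymat`. -/
def Ymatinv : Matrix (Fin 3) (Fin 3) R2 := (T (-2) : R2) • !![0,1,1; T 1,0,T 1; T 1,0,0]

lemma Xmat_mul_Xmatinv : Xmat * Xmatinv = 1 := by
  rw [Xmat, Xmatinv, Matrix.smul_mul, Matrix.mul_smul, smul_smul, ← T_add]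
  simp only [Matrix.mul_fin_three, mul_zero, zero_mul, mul_one, one_mul, add_zero, zero_add,
    ← T_add, CharTwo.add_self_eq_zero]
  rw [Matrix.one_fin_three]
  simp only [Matrix.smul_of, Matrix.smul_cons, smul_eq_mul, Matrix.smul_empty, ← T_add,
    mul_zero, mul_one]
  norm_num [T_zero]

lemma Xmatinv_mul_Xmat : Xmatinv * Xmat = 1 := by
  rw [Xmat, Xmatinv, Matrix.smul_mul, Matrix.mul_smul, smul_smul, ← T_add]
  simp only [Matrix.mul_fin_three, mul_zero, zero_mul, mul_one, one_mul, add_zero, zero_add,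
    ← T_add, CharTwo.add_self_eq_zero]
  rw [Matrix.one_fin_three]
  simp only [Matrix.smul_of, Matrix.smul_cons, smul_eq_mul, Matrix.smul_empty, ← T_add,
    mul_zero, mul_one]
  norm_num [T_zero]

lemma Ymat_mul_Ymatinv : Ymat * Ymatinv = 1 := by
  rw [Ymat, Ymatinv, Matrix.smul_mul, Matrix.mul_smul, smul_smul, ← T_add]
  simp only [Matrix.mul_fin_three, mul_zero, zero_mul, mul_one, one_mul, add_zero, zero_add,
    ← T_add, CharTwo.add_self_eq_zero]
  rw [Matrix.one_fin_three]
  simp only [Matrix.smul_of, Matrix.smul_cons, smul_eq_mul, Matrix.smul_empty, ← T_add,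
    mul_zero, mul_one]
  norm_num [T_zero]

lemma Ymatinv_mul_Ymat : Ymatinv * Ymat = 1 := by
  rw [Ymat, Ymatinv, Matrix.mul_smul, Matrix.smul_mul, smul_smul, ← T_add]
  simp only [Matrix.mul_fin_three, mul_zero, zero_mul, mul_one, one_mul, add_zero, zero_add,
    ← T_add, CharTwo.add_self_eq_zero]
  rw [Matrix.one_fin_three]
  simp only [Matrix.smul_of, Matrix.smul_cons, smul_eq_mul, Matrix.smul_empty, ← T_add,
    mul_zero, mul_one]
  norm_num [T_zero]

/-- `X ∈ GL(3, 𝔽₂[t,t⁻¹])`, the mod-2 reduced Burau image of `σ₁σ₂σ₃`. -/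
def X : GL (Fin 3) R2 := ⟨Xmat, Xmatinv, Xmat_mul_Xmatinv, Xmatinv_mul_Xmat⟩

/-- `Y ∈ GL(3, 𝔽₂[t,t⁻¹])`, the mod-2 reduced Burau image of `σ₁σ₂σ₃σ₁`. -/
def Y : GL (Fin 3) R2 := ⟨Ymat, Ymatinv, Ymat_mul_Ymatinv, Ymatinv_mul_Ymat⟩

/-- `PGL(3, R)`, the projective general linear group: `GL(3,R)` modulo its center
(the subgroup of scalars). -/
abbrev PGL3 : Type := GL (Fin 3) R2 ⧸ Subgroup.center (GL (Fin 3) R2)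

/-- The natural projection `p : GL(3,R) → PGL(3,R)`. -/
def pp : GL (Fin 3) R2 →* PGL3 := QuotientGroup.mk' (Subgroup.center (GL (Fin 3) R2))

/-- `Q_{4,2}`, the subgroup of `PGL(3,R)` generated by `p(X)` and `p(Y)`. -/
abbrev Q42 : Subgroup PGL3 := Subgroup.closure {pp X, pp Y}

/-- The relators `{y³} ∪ {x_i⁴ : i ≥ 0} ∪ {[x_i², yxy] : i ≥ 0}` in the free group on
two generators `x, y`. -/
def q42Rels : Set (FreeGroup (Fin 2)) :=
  {(FreeGroup.of 1) ^ 3} ∪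
    {r | ∃ i : ℕ, r = xseq (FreeGroup.of 0) (FreeGroup.of 1) i ^ 4} ∪
    {r | ∃ i : ℕ, r = br (xseq (FreeGroup.of 0) (FreeGroup.of 1) i ^ 2)
      (FreeGroup.of 1 * FreeGroup.of 0 * FreeGroup.of 1)}


/-! ### Laurent polynomials over `𝔽₂`: supports and widths -/

lemma zmod2_cases (a : ZMod 2) : a = 0 ∨ a = 1 := by
  fin_cases a
  · left; rfl
  · right; rfl

instance : NoZeroDivisors R2 := inferInstance
instance : IsDomain R2 := inferInstance

/-- The support of `p` is contained in `[l, h]`. -/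
def Supp (p : R2) (l h : ℤ) : Prop := ∀ k, p.coeff k ≠ 0 → l ≤ k ∧ k ≤ h

/-- The support of `p` spans exactly `[l, h]`. -/
def Ex (p : R2) (l h : ℤ) : Prop := Supp p l h ∧ p.coeff l = 1 ∧ p.coeff h = 1

lemma coeff_T_mul (k : ℤ) (p : R2) (m : ℤ) : (T k * p).coeff m = p.coeff (m - k) := by
  rw [T, AddMonoidAlgebra.coeff_single_mul_eq_mul_coeff (m₂ := m - k)]
  · simp
  · intro m' _
    constructor <;> intro h <;> omega

lemma coeff_one_add_T_mul (p : R2) (m : ℤ) :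
    ((1 + T 1) * p).coeff m = p.coeff m + p.coeff (m - 1) := by
  rw [add_mul, one_mul, AddMonoidAlgebra.coeff_add, Finsupp.add_apply, coeff_T_mul]

lemma coeff_add' (p q : R2) (m : ℤ) : (p + q).coeff m = p.coeff m + q.coeff m := rfl

lemma Supp.le_of {p : R2} {l h k : ℤ} (hp : Supp p l h) (hk : p.coeff k ≠ 0) : l ≤ k ∧ k ≤ h :=
  hp k hk

lemma Supp.zero_of {p : R2} {l h k : ℤ} (hp : Supp p l h) (hk : k < l ∨ h < k) :
    p.coeff k = 0 := by
  by_contra hne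
  have := hp k hne
  omega

lemma Supp.mono {p : R2} {l h l' h' : ℤ} (hp : Supp p l h) (h1 : l' ≤ l) (h2 : h ≤ h') :
    Supp p l' h' := fun k hk => ⟨h1.trans (hp k hk).1, (hp k hk).2.trans h2⟩

lemma Supp.add {p q : R2} {l h : ℤ} (hp : Supp p l h) (hq : Supp q l h) : Supp (p + q) l h := by
  intro k hk
  by_contra hcon
  rw [coeff_add', hp.zero_of (by omega), hq.zero_of (by omega), add_zero] at hk
  exact hk rfl

lemma Supp.T_mul {p : R2} {l h : ℤ} (hp : Supp p l h) (k : ℤ) :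
    Supp (T k * p) (l + k) (h + k) := by
  intro m hm
  rw [coeff_T_mul] at hm
  have := hp _ hm
  omega

lemma Supp.one_add {p : R2} {l h : ℤ} (hp : Supp p l h) : Supp ((1 + T 1) * p) l (h + 1) := by
  intro m hm
  rw [coeff_one_add_T_mul] at hm
  by_contra hcon
  rw [hp.zero_of (by omega), hp.zero_of (by omega), add_zero] at hm
  exact hm rfl

lemma Supp.lo {p : R2} {l h : ℤ} (hp : Supp p l h) (h0 : p.coeff l = 0) : Supp p (l + 1) h := by
  intro k hk
  have := hp k hk
  have : k ≠ l := by rintro rfl; exact hk h0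
  omega

lemma Supp.hi {p : R2} {l h : ℤ} (hp : Supp p l h) (h0 : p.coeff h = 0) : Supp p l (h - 1) := by
  intro k hk
  have := hp k hk
  have : k ≠ h := by rintro rfl; exact hk h0
  omega

lemma Supp.eq_zero {p : R2} {l h : ℤ} (hp : Supp p l h) (hlt : h < l) : p = 0 := by
  ext k
  by_contra hk
  have := hp k hk
  omega

lemma Supp.zero (l h : ℤ) : Supp 0 l h := fun _ hk => absurd rfl hk

lemma Ex.T_mul {p : R2} {l h : ℤ} (hp : Ex p l h) (k : ℤ) : Ex (T k * p) (l + k) (h + k) :=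
  ⟨hp.1.T_mul k, by rw [coeff_T_mul, add_sub_cancel_right]; exact hp.2.1,
    by rw [coeff_T_mul, add_sub_cancel_right]; exact hp.2.2⟩

lemma Ex.le {p : R2} {l h : ℤ} (hp : Ex p l h) : l ≤ h :=
  (hp.1 l (by rw [hp.2.1]; exact one_ne_zero)).2

lemma Ex.ne {p : R2} {l h : ℤ} (hp : Ex p l h) : p ≠ 0 := by
  rintro rfl
  exact zero_ne_one hp.2.1

lemma exists_Ex {p : R2} (hp : p ≠ 0) : ∃ l h, Ex p l h := by
  have hne : p.coeff.support.Nonempty := by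
    rw [Finsupp.support_nonempty_iff]
    simpa using hp
  refine ⟨p.coeff.support.min' hne, p.coeff.support.max' hne, ?_, ?_, ?_⟩
  · intro k hk
    have hk' : k ∈ p.coeff.support := Finsupp.mem_support_iff.2 hk
    exact ⟨Finset.min'_le _ _ hk', Finset.le_max' _ _ hk'⟩
  · exact (zmod2_cases _).resolve_left (Finsupp.mem_support_iff.1 (Finset.min'_mem _ hne))
  · exact (zmod2_cases _).resolve_left (Finsupp.mem_support_iff.1 (Finset.max'_mem _ hne))

/-- The width of a Laurent polynomial: the length of its support interval. -/
def Wd (p : R2) : ℕ := sInf {n : ℕ | ∃ l : ℤ, Supp p l (l + n - 1)}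

lemma Supp.Wd_le {p : R2} {l h : ℤ} {n : ℕ} (hp : Supp p l h) (hn : h - l + 1 ≤ n) : Wd p ≤ n :=
  Nat.sInf_le ⟨l, hp.mono le_rfl (by omega)⟩

lemma Wd_zero : Wd 0 = 0 := Nat.le_zero.1 ((Supp.zero 1 0).Wd_le (by norm_num))

lemma Ex.Wd_eq {p : R2} {l h : ℤ} (hp : Ex p l h) : (Wd p : ℤ) = h - l + 1 := by
  have hle := hp.le
  have h1 : Wd p ≤ (h - l + 1).toNat := hp.1.Wd_le (by omega)
  have hmem : Wd p ∈ {n : ℕ | ∃ l : ℤ, Supp p l (l + n - 1)} :=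
    Nat.sInf_mem ⟨(h - l + 1).toNat, l, hp.1.mono le_rfl (by omega)⟩
  obtain ⟨l', hl'⟩ := hmem
  have h2 := hl' l (by rw [hp.2.1]; exact one_ne_zero)
  have h3 := hl' h (by rw [hp.2.2]; exact one_ne_zero)
  omega

lemma Wd_eq_zero {p : R2} (h : Wd p = 0) : p = 0 := by
  by_contra hp
  obtain ⟨l, h', hE⟩ := exists_Ex hp
  have := hE.Wd_eq
  have := hE.le
  omega

lemma exists_supp_Wd (p : R2) : ∃ l : ℤ, Supp p l (l + Wd p - 1) := by
  by_cases hp : p = 0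
  · subst hp
    exact ⟨0, Supp.zero _ _⟩
  · obtain ⟨l, h, hE⟩ := exists_Ex hp
    exact ⟨l, hE.1.mono le_rfl (by have := hE.Wd_eq; omega)⟩

lemma Wd_T_mul (k : ℤ) (p : R2) : Wd (T k * p) = Wd p := by
  by_cases hp : p = 0
  · subst hp
    rw [mul_zero]
  · obtain ⟨l, h, hE⟩ := exists_Ex hp
    have h1 := hE.Wd_eq
    have h2 := (hE.T_mul k).Wd_eq
    omega

lemma Supp.mul {p q : R2} {l h l' h' : ℤ} (hp : Supp p l h) (hq : Supp q l' h') :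
    Supp (p * q) (l + l') (h + h') := by
  intro k hk
  rw [AddMonoidAlgebra.coeff_mul] at hk
  obtain ⟨i, hi, hi'⟩ := Finset.exists_ne_zero_of_sum_ne_zero hk
  obtain ⟨j, hj, hj'⟩ := Finset.exists_ne_zero_of_sum_ne_zero hi'
  have a1 := hp i (Finsupp.mem_support_iff.1 hi)
  have a2 := hq j (Finsupp.mem_support_iff.1 hj)
  simp only [ne_eq, ite_eq_right_iff, Classical.not_imp] at hj'
  omega

lemma coeff_mul_ext {p q : R2} {i j : ℤ}
    (hh : ∀ i' j', p.coeff i' ≠ 0 → q.coeff j' ≠ 0 → i' + j' = i + j → i' = i ∧ j' = j) :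
    (p * q).coeff (i + j) = p.coeff i * q.coeff j := by
  rw [AddMonoidAlgebra.coeff_mul]
  simp only [Finsupp.sum]
  rw [Finset.sum_eq_single i]
  · rw [Finset.sum_eq_single j]
    · simp
    · intro j' hj' hne
      rw [if_neg]
      intro h
      omega
    · intro hj
      simp [Finsupp.notMem_support_iff.1 hj]
  · intro i' hi' hne
    apply Finset.sum_eq_zero
    intro j' hj'
    rw [if_neg]
    intro h
    exact hne (hh i' j' (Finsupp.mem_support_iff.1 hi') (Finsupp.mem_support_iff.1 hj') h).1
  · intro hi
    simp [Finsupp.notMem_support_iff.1 hi]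

lemma Supp.coeff_mul_hi {p q : R2} {l h l' h' : ℤ} (hp : Supp p l h) (hq : Supp q l' h') :
    (p * q).coeff (h + h') = p.coeff h * q.coeff h' := by
  apply coeff_mul_ext
  intro i j hi hj hij
  have a1 := hp i hi
  have a2 := hq j hj
  omega

lemma Supp.coeff_mul_lo {p q : R2} {l h l' h' : ℤ} (hp : Supp p l h) (hq : Supp q l' h') :
    (p * q).coeff (l + l') = p.coeff l * q.coeff l' := by
  apply coeff_mul_ext
  intro i j hi hj hij
  have a1 := hp i hi
  have a2 := hq j hj
  omega

lemma Ex.mul {p q : R2} {l h l' h' : ℤ} (hp : Ex p l h) (hq : Ex q l' h') :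
    Ex (p * q) (l + l') (h + h') :=
  ⟨hp.1.mul hq.1, by rw [hp.1.coeff_mul_lo hq.1, hp.2.1, hq.2.1, one_mul],
    by rw [hp.1.coeff_mul_hi hq.1, hp.2.2, hq.2.2, one_mul]⟩

/-- The involution `t ↦ t⁻¹`. -/
def bar (p : R2) : R2 := invert p

lemma bar_add (p q : R2) : bar (p + q) = bar p + bar q := map_add _ _ _
lemma bar_mul (p q : R2) : bar (p * q) = bar p * bar q := map_mul _ _ _
lemma bar_one : bar 1 = 1 := map_one _
lemma bar_zero : bar 0 = 0 := map_zero _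
lemma bar_T (k : ℤ) : bar (T k) = T (-k) := invert_T k
lemma bar_bar (p : R2) : bar (bar p) = p := involutive_invert p
lemma coeff_bar (p : R2) (k : ℤ) : (bar p).coeff k = p.coeff (-k) := invert_apply p k

lemma Supp.bar {p : R2} {l h : ℤ} (hp : Supp p l h) : Supp (bar p) (-h) (-l) := by
  intro k hk
  rw [coeff_bar] at hk
  have := hp _ hk
  omega

lemma Ex.bar {p : R2} {l h : ℤ} (hp : Ex p l h) : Ex (bar p) (-h) (-l) :=
  ⟨hp.1.bar, by rw [coeff_bar, neg_neg]; exact hp.2.2, by rw [coeff_bar, neg_neg]; exact hp.2.1⟩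

lemma Ex_one : Ex (1 : R2) 0 0 := by
  refine ⟨?_, ?_, ?_⟩
  · intro k hk
    rw [← T_zero, T_apply] at hk
    by_cases h : 0 = k
    · omega
    · exact absurd (if_neg h) hk
  · rw [← T_zero, T_apply, if_pos rfl]
  · rw [← T_zero, T_apply, if_pos rfl]

lemma Ex_T (k : ℤ) : Ex (T k : R2) k k := by
  have := Ex_one.T_mul k
  simpa using this

lemma Ex_one_add : Ex (1 + T 1 : R2) 0 1 := by
  have h := Ex_one.1.one_add
  rw [mul_one, zero_add] at h
  refine ⟨h, ?_, ?_⟩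
  · rw [coeff_add', Ex_one.2.1, T_apply]; simp
  · rw [coeff_add', Ex_one.1.zero_of (Or.inr one_pos), T_apply]; simp

lemma one_add_ne : (1 + T 1 : R2) ≠ 0 := Ex_one_add.ne

lemma Ex.unique {p : R2} {l h l' h' : ℤ} (hp : Ex p l h) (hq : Ex p l' h') : l = l' ∧ h = h' := by
  have a1 := hp.1 l' (by rw [hq.2.1]; exact one_ne_zero)
  have a2 := hp.1 h' (by rw [hq.2.2]; exact one_ne_zero)
  have a3 := hq.1 l (by rw [hp.2.1]; exact one_ne_zero)
  have a4 := hq.1 h (by rw [hp.2.2]; exact one_ne_zero)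
  omega

lemma zmod2_add_self (a : ZMod 2) : a + a = 0 := CharTwo.add_self_eq_zero a

/-! ### The conjugated representation -/

lemma two_eq : (2 : R2) = 0 := CharTwo.two_eq_zero
lemma TT : (T 1 : R2) * T (-1) = 1 := by rw [← T_add]; exact T_zero
lemma T2 : (T (-2) : R2) = T (-1) * T (-1) := by rw [← T_add]; rfl

lemma mat3_ext {a b c d e f g h i a' b' c' d' e' f' g' h' i' : R2}
    (h1 : a = a') (h2 : b = b') (h3 : c = c') (h4 : d = d') (h5 : e = e') (h6 : f = f')
    (h7 : g = g') (h8 : h = h') (h9 : i = i') :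
    (!![a,b,c; d,e,f; g,h,i] : Matrix (Fin 3) (Fin 3) R2) = !![a',b',c'; d',e',f'; g',h',i'] := by
  rw [h1, h2, h3, h4, h5, h6, h7, h8, h9]

lemma mat3_smul {a b c d e f g h i r : R2} :
    r • (!![a,b,c; d,e,f; g,h,i] : Matrix (Fin 3) (Fin 3) R2)
      = !![r*a,r*b,r*c; r*d,r*e,r*f; r*g,r*h,r*i] := by
  simp only [Matrix.smul_of, Matrix.smul_cons, smul_eq_mul, Matrix.smul_empty]

def XrM : Matrix (Fin 3) (Fin 3) R2 := !![1,1,T 1; 0,1,1+T 1; 0,0,1]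
def XrI : Matrix (Fin 3) (Fin 3) R2 := !![1,1,1; 0,1,1+T 1; 0,0,1]
def YrM : Matrix (Fin 3) (Fin 3) R2 := !![0,0,T 1; 0,1,1+T 1; 1,1,1]
def YrI : Matrix (Fin 3) (Fin 3) R2 := !![1,1,1; 1+T (-1),1,0; T (-1),0,0]

lemma XrM_mul : XrM * XrI = 1 := by
  rw [XrM, XrI, Matrix.mul_fin_three, Matrix.one_fin_three]
  have h2 := two_eq
  refine mat3_ext ?_ ?_ ?_ ?_ ?_ ?_ ?_ ?_ ?_ <;> grind

lemma XrI_mul : XrI * XrM = 1 := by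
  rw [XrM, XrI, Matrix.mul_fin_three, Matrix.one_fin_three]
  have h2 := two_eq
  refine mat3_ext ?_ ?_ ?_ ?_ ?_ ?_ ?_ ?_ ?_ <;> grind

lemma YrM_mul : YrM * YrI = 1 := by
  rw [YrM, YrI, Matrix.mul_fin_three, Matrix.one_fin_three]
  have h2 := two_eq
  have ht := TT
  refine mat3_ext ?_ ?_ ?_ ?_ ?_ ?_ ?_ ?_ ?_ <;> grind

lemma YrI_mul : YrI * YrM = 1 := by
  rw [YrM, YrI, Matrix.mul_fin_three, Matrix.one_fin_three]
  have h2 := two_eq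
  have ht := TT
  refine mat3_ext ?_ ?_ ?_ ?_ ?_ ?_ ?_ ?_ ?_ <;> grind

def Xr : GL (Fin 3) R2 := ⟨XrM, XrI, XrM_mul, XrI_mul⟩
def Yr : GL (Fin 3) R2 := ⟨YrM, YrI, YrM_mul, YrI_mul⟩

abbrev FF : Type := FreeGroup (Fin 2)
def gx : FF := FreeGroup.of 0
def gy : FF := FreeGroup.of 1
def gf : FF := gy * gx
def gz : FF := gy * gx * gy
def gD : FF := gf * gf

def rho : FF →* GL (Fin 3) R2 := FreeGroup.lift ![Xr, Yr]

lemma rho_x : (rho gx).val = XrM := by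
  simp only [rho, gx, FreeGroup.lift_apply_of]
  rfl
lemma rho_y : (rho gy).val = YrM := by
  simp only [rho, gy, FreeGroup.lift_apply_of]
  rfl
lemma rho_xi : (rho gx⁻¹).val = XrI := by
  rw [map_inv]
  simp only [rho, gx, FreeGroup.lift_apply_of]
  rfl
lemma rho_yi : (rho gy⁻¹).val = YrI := by
  rw [map_inv]
  simp only [rho, gy, FreeGroup.lift_apply_of]
  rfl
lemma rho_mul (g h : FF) : (rho (g * h)).val = (rho g).val * (rho h).val := by
  rw [map_mul]; rfl
lemma rho_one : (rho 1).val = 1 := by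
  rw [map_one]; rfl

lemma rho_f : (rho gf).val = !![0,0,T 1; 0,1,0; 1,0,0] := by
  rw [gf, rho_mul, rho_x, rho_y, XrM, YrM, Matrix.mul_fin_three]
  have h2 := two_eq
  refine mat3_ext ?_ ?_ ?_ ?_ ?_ ?_ ?_ ?_ ?_ <;> grind

lemma rho_fi : (rho gf⁻¹).val = !![0,0,1; 0,1,0; T (-1),0,0] := by
  rw [gf, _root_.mul_inv_rev, rho_mul, rho_xi, rho_yi, XrI, YrI, Matrix.mul_fin_three]
  have h2 := two_eq
  have ht := TT
  refine mat3_ext ?_ ?_ ?_ ?_ ?_ ?_ ?_ ?_ ?_ <;> grind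

lemma rho_D : (rho gD).val = !![T 1,0,0; 0,1,0; 0,0,T 1] := by
  rw [gD, rho_mul, rho_f, Matrix.mul_fin_three]
  refine mat3_ext ?_ ?_ ?_ ?_ ?_ ?_ ?_ ?_ ?_ <;> grind

lemma rho_Di : (rho gD⁻¹).val = !![T (-1),0,0; 0,1,0; 0,0,T (-1)] := by
  rw [gD, _root_.mul_inv_rev, rho_mul, rho_fi, Matrix.mul_fin_three]
  refine mat3_ext ?_ ?_ ?_ ?_ ?_ ?_ ?_ ?_ ?_ <;> grind

lemma gD_eq : gD = gz * gx := by
  simp only [gD, gf, gz, mul_assoc]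

lemma gy_eq : gy = gf * gx⁻¹ := by
  simp only [gf, mul_inv_cancel_right]

lemma diag_mul (p q p' q' : R2) :
    (!![p,0,0; 0,q,0; 0,0,p] : Matrix (Fin 3) (Fin 3) R2) * !![p',0,0; 0,q',0; 0,0,p']
      = !![p*p',0,0; 0,q*q',0; 0,0,p*p'] := by
  rw [Matrix.mul_fin_three]
  refine mat3_ext ?_ ?_ ?_ ?_ ?_ ?_ ?_ ?_ ?_ <;> grind

lemma rho_Dz (k : ℤ) : (rho (gD ^ k)).val = !![T k,0,0; 0,1,0; 0,0,T k] := by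
  induction k using Int.induction_on with
  | zero =>
    rw [_root_.zpow_zero, rho_one, T_zero, Matrix.one_fin_three]
  | succ n ih =>
    rw [_root_.zpow_add_one, rho_mul, ih, rho_D, diag_mul, T_add, one_mul]
  | pred n ih =>
    rw [_root_.zpow_sub_one, rho_mul, ih, rho_Di, diag_mul, sub_eq_add_neg, T_add, one_mul]

/-- The state of `g` : the bottom row of `rho g` is `(sc g, sb g, sa g)`. -/
def sa (g : FF) : R2 := (rho g).val 2 2
def sb (g : FF) : R2 := (rho g).val 2 1
def sc (g : FF) : R2 := (rho g).val 2 0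

lemma state_mul (g h : FF) (m : Matrix (Fin 3) (Fin 3) R2) (hm : (rho h).val = m) :
    sa (g * h) = sc g * m 0 2 + sb g * m 1 2 + sa g * m 2 2 ∧
    sb (g * h) = sc g * m 0 1 + sb g * m 1 1 + sa g * m 2 1 ∧
    sc (g * h) = sc g * m 0 0 + sb g * m 1 0 + sa g * m 2 0 := by
  subst hm
  unfold sa sb sc
  rw [rho_mul]
  refine ⟨?_, ?_, ?_⟩ <;> rw [Matrix.mul_apply, Fin.sum_univ_three]

lemma st_x (g : FF) : sa (g * gx) = sa g + (1 + T 1) * sb g + T 1 * sc g ∧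
    sb (g * gx) = sb g + sc g ∧ sc (g * gx) = sc g := by
  obtain ⟨h1, h2, h3⟩ := state_mul g gx _ rho_x
  simp [XrM] at h1 h2 h3
  refine ⟨?_, ?_, h3⟩
  · rw [h1]; ring
  · rw [h2]; ring

lemma st_xi (g : FF) : sa (g * gx⁻¹) = sa g + (1 + T 1) * sb g + sc g ∧
    sb (g * gx⁻¹) = sb g + sc g ∧ sc (g * gx⁻¹) = sc g := by
  obtain ⟨h1, h2, h3⟩ := state_mul g gx⁻¹ _ rho_xi
  simp [XrI] at h1 h2 h3
  refine ⟨?_, ?_, h3⟩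
  · rw [h1]; ring
  · rw [h2]; ring

lemma st_f (g : FF) : sa (g * gf) = T 1 * sc g ∧ sb (g * gf) = sb g ∧ sc (g * gf) = sa g := by
  obtain ⟨h1, h2, h3⟩ := state_mul g gf _ rho_f
  simp at h1 h2 h3
  exact ⟨h1.trans (mul_comm _ _), h2, h3⟩

lemma st_fi (g : FF) : sa (g * gf⁻¹) = sc g ∧ sb (g * gf⁻¹) = sb g ∧
    sc (g * gf⁻¹) = T (-1) * sa g := by
  obtain ⟨h1, h2, h3⟩ := state_mul g gf⁻¹ _ rho_fi
  simp at h1 h2 h3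
  exact ⟨h1, h2, h3.trans (mul_comm _ _)⟩

lemma st_D (g : FF) (k : ℤ) : sa (g * gD ^ k) = T k * sa g ∧ sb (g * gD ^ k) = sb g ∧
    sc (g * gD ^ k) = T k * sc g := by
  obtain ⟨h1, h2, h3⟩ := state_mul g _ _ (rho_Dz k)
  simp at h1 h2 h3
  exact ⟨h1.trans (mul_comm _ _), h2, h3.trans (mul_comm _ _)⟩

lemma st_one : sa 1 = 1 ∧ sb 1 = 0 ∧ sc 1 = 0 := by
  unfold sa sb sc
  rw [rho_one]
  simp

lemma ff_induct {M : FF → Prop} (h1 : M 1) (hx : ∀ g, M g → M (g * gx))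
    (hxi : ∀ g, M g → M (g * gx⁻¹)) (hf : ∀ g, M g → M (g * gf))
    (hfi : ∀ g, M g → M (g * gf⁻¹)) (g : FF) : M g := by
  have key : ∀ g : FF, ∀ k, M k → M (k * g) := by
    intro g
    induction g using FreeGroup.induction_on with
    | C1 => intro k hk; rwa [mul_one]
    | of i =>
      intro k hk
      fin_cases i
      · exact hx k hk
      · have : k * gy = k * gf * gx⁻¹ := by rw [mul_assoc, ← gy_eq]
        change M (k * gy)
        rw [this]
        exact hxi _ (hf _ hk)
    | inv_of i _ =>
      intro k hk
      fin_cases i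
      · exact hxi k hk
      · have : k * gy⁻¹ = k * gx * gf⁻¹ := by
          rw [gy_eq, _root_.mul_inv_rev, inv_inv, mul_assoc]
        change M (k * gy⁻¹)
        rw [this]
        exact hfi _ (hx _ hk)
    | mul a b ha hb =>
      intro k hk
      rw [← mul_assoc]
      exact hb _ (ha _ hk)
  simpa using key g 1 h1

/-- The state vector is isotropic. -/
lemma iso (g : FF) :
    sa g * bar (sc g) + T 1 * bar (sa g) * sc g = (1 + T 1) * (sb g * bar (sb g)) := by
  have h2 := two_eq
  have ht := TT
  induction g using ff_induct with
  | h1 =>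
    obtain ⟨e1, e2, e3⟩ := st_one
    rw [e1, e2, e3, bar_zero]
    ring
  | hx g ih =>
    obtain ⟨e1, e2, e3⟩ := st_x g
    rw [e1, e2, e3]
    simp only [bar_add, bar_mul, bar_one, bar_T]
    grind
  | hxi g ih =>
    obtain ⟨e1, e2, e3⟩ := st_xi g
    rw [e1, e2, e3]
    simp only [bar_add, bar_mul, bar_one, bar_T]
    grind
  | hf g ih =>
    obtain ⟨e1, e2, e3⟩ := st_f g
    rw [e1, e2, e3]
    simp only [bar_add, bar_mul, bar_one, bar_T]
    grind
  | hfi g ih =>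
    obtain ⟨e1, e2, e3⟩ := st_fi g
    rw [e1, e2, e3]
    simp only [bar_mul, bar_T, neg_neg]
    grind

lemma st_ne (g : FF) : ¬ (sa g = 0 ∧ sb g = 0 ∧ sc g = 0) := by
  rintro ⟨h1, h2, h3⟩
  obtain ⟨e1, -, -⟩ := state_mul g g⁻¹ _ rfl
  rw [h1, h2, h3, mul_inv_cancel, st_one.1] at e1
  simp at e1

lemma mul_self_bar_eq_zero {p : R2} (h : p * bar p = 0) : p = 0 := by
  rcases mul_eq_zero.1 h with h | h
  · exact h
  · rw [← bar_bar p, h, bar_zero]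

lemma sb_zero_of_sc {g : FF} (h : sc g = 0) : sb g = 0 := by
  have := iso g
  rw [h, bar_zero, mul_zero, mul_zero, add_zero] at this
  exact mul_self_bar_eq_zero ((mul_eq_zero.1 this.symm).resolve_left one_add_ne)

lemma sc_ne_of_sa {g : FF} (h : sa g = 0) : sc g ≠ 0 := fun h' =>
  st_ne g ⟨h, sb_zero_of_sc h', h'⟩

/-- the change of basis matrix -/
def PM : Matrix (Fin 3) (Fin 3) R2 := !![1+T 1, T 1, 1+T 1; 0, 1+T 1, (1+T 1)*(1+T 1); 1+T 1, 1, 1+T 1]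

lemma P_X : Xmat * PM = (T 1 : R2) • (PM * XrM) := by
  rw [Xmat, XrM, PM, Matrix.smul_mul, Matrix.mul_fin_three, Matrix.mul_fin_three, mat3_smul, mat3_smul]
  have h2 := two_eq
  refine mat3_ext ?_ ?_ ?_ ?_ ?_ ?_ ?_ ?_ ?_ <;> grind

lemma P_Xi : Xmatinv * PM = (T (-1) : R2) • (PM * XrI) := by
  rw [Xmatinv, XrI, PM, Matrix.smul_mul, Matrix.mul_fin_three, Matrix.mul_fin_three, mat3_smul, mat3_smul]
  have h2 := two_eq
  refine mat3_ext ?_ ?_ ?_ ?_ ?_ ?_ ?_ ?_ ?_ <;> grind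

lemma P_Y : Ymat * PM = (T 1 : R2) • (PM * YrM) := by
  rw [Ymat, YrM, PM, Matrix.smul_mul, Matrix.mul_fin_three, Matrix.mul_fin_three, mat3_smul, mat3_smul]
  have h2 := two_eq
  refine mat3_ext ?_ ?_ ?_ ?_ ?_ ?_ ?_ ?_ ?_ <;> grind

lemma P_Yi : Ymatinv * PM = (T (-1) : R2) • (PM * YrI) := by
  have h : PM = (T 1 : R2) • (Ymatinv * (PM * YrM)) := by
    rw [← Matrix.mul_smul, ← P_Y, ← Matrix.mul_assoc, Ymatinv_mul_Ymat, Matrix.one_mul]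
  have h' : PM * YrI = (T 1 : R2) • (Ymatinv * PM) := by
    conv_lhs => rw [h]
    rw [Matrix.smul_mul, Matrix.mul_assoc, Matrix.mul_assoc, YrM_mul, Matrix.mul_one]
  rw [h', smul_smul, mul_comm, TT, one_smul]

def lft : FF →* GL (Fin 3) R2 := FreeGroup.lift ![X, Y]

lemma lft_x : (lft gx).val = Xmat := by
  simp only [lft, gx, FreeGroup.lift_apply_of]
  rfl
lemma lft_y : (lft gy).val = Ymat := by
  simp only [lft, gy, FreeGroup.lift_apply_of]
  rfl
lemma lft_xi : (lft gx⁻¹).val = Xmatinv := by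
  rw [map_inv]
  simp only [lft, gx, FreeGroup.lift_apply_of]
  rfl
lemma lft_yi : (lft gy⁻¹).val = Ymatinv := by
  rw [map_inv]
  simp only [lft, gy, FreeGroup.lift_apply_of]
  rfl

lemma intertwine (g : FF) : ∃ k : ℤ, (lft g).val * PM = (T k : R2) • (PM * (rho g).val) := by
  induction g using FreeGroup.induction_on with
  | C1 =>
    refine ⟨0, ?_⟩
    rw [map_one, rho_one, T_zero, one_smul, Units.val_one, Matrix.one_mul, Matrix.mul_one]
  | of i =>
    refine ⟨1, ?_⟩
    fin_cases i
    · change (lft gx).val * PM = (T 1 : R2) • (PM * (rho gx).val)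
      rw [rho_x, ← P_X, lft_x]
    · change (lft gy).val * PM = (T 1 : R2) • (PM * (rho gy).val)
      rw [rho_y, ← P_Y, lft_y]
  | inv_of i _ =>
    refine ⟨-1, ?_⟩
    fin_cases i
    · change (lft gx⁻¹).val * PM = (T (-1) : R2) • (PM * (rho gx⁻¹).val)
      rw [rho_xi, ← P_Xi, lft_xi]
    · change (lft gy⁻¹).val * PM = (T (-1) : R2) • (PM * (rho gy⁻¹).val)
      rw [rho_yi, ← P_Yi, lft_yi]
  | mul a b ha hb =>
    obtain ⟨k, hk⟩ := ha
    obtain ⟨l, hl⟩ := hb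
    refine ⟨l + k, ?_⟩
    rw [map_mul, rho_mul, Units.val_mul, Matrix.mul_assoc, hl, Matrix.mul_smul,
      ← Matrix.mul_assoc, hk, Matrix.smul_mul, smul_smul, ← T_add, Matrix.mul_assoc]

lemma PM_det_ne : PM.det ≠ 0 := by
  have h2 := two_eq
  have : PM.det = (1 + T 1) * ((1 + T 1) * ((1 + T 1) * (1 + T 1))) := by
    rw [PM, Matrix.det_fin_three]
    simp
    grind
  rw [this]
  exact mul_ne_zero one_add_ne (mul_ne_zero one_add_ne (mul_ne_zero one_add_ne one_add_ne))

lemma PM_cancel {m m' : Matrix (Fin 3) (Fin 3) R2} (h : PM * m = PM * m') : m = m' := by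
  have h2 : PM.adjugate * (PM * m) = PM.adjugate * (PM * m') := by rw [h]
  rw [← Matrix.mul_assoc, ← Matrix.mul_assoc, Matrix.adjugate_mul, Matrix.smul_mul,
    Matrix.smul_mul, Matrix.one_mul, Matrix.one_mul] at h2
  ext1 i j
  have h3 := congrFun (congrFun h2 i) j
  simp only [Matrix.smul_apply, smul_eq_mul] at h3
  exact mul_left_cancel₀ PM_det_ne h3

lemma PM_cancel_right {m m' : Matrix (Fin 3) (Fin 3) R2} (h : m * PM = m' * PM) : m = m' := by
  have h2 : m * PM * PM.adjugate = m' * PM * PM.adjugate := by rw [h]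
  rw [Matrix.mul_assoc, Matrix.mul_assoc, Matrix.mul_adjugate, Matrix.mul_smul,
    Matrix.mul_smul, Matrix.mul_one, Matrix.mul_one] at h2
  ext1 i j
  have h3 := congrFun (congrFun h2 i) j
  simp only [Matrix.smul_apply, smul_eq_mul] at h3
  exact mul_left_cancel₀ PM_det_ne h3

lemma pp_eq_one_iff (g : FF) : pp (lft g) = 1 ↔ ∃ r : R2, (rho g).val = Matrix.scalar (Fin 3) r := by
  rw [pp, QuotientGroup.mk'_apply, QuotientGroup.eq_one_iff,
    Matrix.GeneralLinearGroup.mem_center_iff_val_mem_range_scalar]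
  obtain ⟨k, hk⟩ := intertwine g
  constructor
  · rintro ⟨r, hr⟩
    refine ⟨T (-k) * r, PM_cancel ?_⟩
    have : PM * (rho g).val = (T (-k) : R2) • ((lft g).val * PM) := by
      rw [hk, smul_smul, ← T_add, neg_add_cancel, T_zero, one_smul]
    rw [this, ← hr]
    ext1 i j
    simp [Matrix.mul_apply, Matrix.diagonal]
    ring
  · rintro ⟨r, hr⟩
    refine ⟨T k * r, PM_cancel_right ?_⟩
    rw [hk, hr]
    ext1 i j
    simp [Matrix.mul_apply, Matrix.diagonal]
    ring

lemma lift_eq (g : FF) : FreeGroup.lift ![pp X, pp Y] g = pp (lft g) := by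
  have : FreeGroup.lift ![pp X, pp Y] = pp.comp lft := by
    ext i
    fin_cases i <;> simp [lft]
  rw [this]; rfl

/-! ### Abstract group theory -/

section Abs
open scoped commutatorElement
variable {H : Type*} [Group H]

/-- conjugates `z^{-k} x z^k` -/
def Wj (z x : H) (k : ℤ) : H := z ^ (-k) * x * z ^ k

/-- the commutator sequence -/
def zseq (z x : H) : ℕ → H
  | 0 => x
  | n + 1 => br z (zseq z x n)

lemma Wj_zero (z x : H) : Wj z x 0 = x := by simp [Wj]

lemma Wj_conj (z x : H) (k j : ℤ) : z ^ (-j) * Wj z x k * z ^ j = Wj z x (k + j) := by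
  simp only [Wj]
  rw [neg_add, _root_.zpow_add z k j, add_comm (-k) (-j), _root_.zpow_add z (-j) (-k)]
  simp only [mul_assoc]

lemma Wj_conj1 (z x : H) (k : ℤ) : z⁻¹ * Wj z x k * z = Wj z x (k + 1) := by
  have := Wj_conj z x k 1
  rwa [_root_.zpow_neg, zpow_one] at this

lemma Wj_comm_shift {z x : H} {i j : ℤ} (h : Commute (Wj z x (i - j)) x) :
    Commute (Wj z x i) (Wj z x j) := by
  have h1 : Wj z x i = z ^ (-j) * Wj z x (i - j) * z ^ j := by
    rw [Wj_conj, sub_add_cancel]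
  have h2 : Wj z x j = z ^ (-j) * x * z ^ j := rfl
  rw [h1, h2]
  have h3 : ∀ g, z ^ (-j) * g * z ^ j = MulAut.conj (z ^ (-j)) g := by
    intro g
    rw [MulAut.conj_apply, _root_.zpow_neg, inv_inv]
  rw [h3, h3]
  exact h.map (MulAut.conj (z ^ (-j)))

lemma Wj_sq (z x : H) (k : ℤ) : Wj z x k * Wj z x k = z ^ (-k) * (x * x) * z ^ k := by
  simp only [Wj, _root_.zpow_neg]
  group

lemma comm_closure {S S' : Set H} (hc : ∀ a ∈ S, ∀ b ∈ S', Commute a b) {a b : H}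
    (ha : a ∈ Subgroup.closure S) (hb : b ∈ Subgroup.closure S') : Commute a b := by
  have h1 : ∀ a ∈ S, Commute a b := by
    intro a ha
    have : Subgroup.closure S' ≤ Subgroup.centralizer {a} := by
      rw [Subgroup.closure_le]
      intro b hb
      exact Subgroup.mem_centralizer_singleton_iff.2 (hc a ha b hb).symm
    exact (Subgroup.mem_centralizer_singleton_iff.1 (this hb)).symm
  have : Subgroup.closure S ≤ Subgroup.centralizer {b} := by
    rw [Subgroup.closure_le]
    intro a ha
    exact Subgroup.mem_centralizer_singleton_iff.2 (h1 a ha)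
  exact Subgroup.mem_centralizer_singleton_iff.1 (this ha)

lemma invol_closure {S : Set H} (hc : ∀ a ∈ S, ∀ b ∈ S, Commute a b) (hs : ∀ a ∈ S, a * a = 1)
    {a : H} (ha : a ∈ Subgroup.closure S) : a * a = 1 := by
  induction ha using Subgroup.closure_induction with
  | mem a ha => exact hs a ha
  | one => rw [one_mul]
  | mul a b ha hb iha ihb =>
    have := comm_closure hc ha hb
    calc a * b * (a * b) = a * (b * a) * b := by simp only [mul_assoc]
      _ = a * (a * b) * b := by rw [this.eq]
      _ = (a * a) * (b * b) := by simp only [mul_assoc]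
      _ = 1 := by rw [iha, ihb, one_mul]
  | inv a ha iha => rw [← _root_.mul_inv_rev, iha, inv_one]

lemma zseq_sq (z x : H) (n : ℕ) (hn : 1 ≤ n) (hx : x * x = 1)
    (hcm : ∀ k : ℕ, 0 < k → k < n → Commute (Wj z x k) x) :
    zseq z x n * zseq z x n = Wj z x n * x * (Wj z x n * x) := by
  have hsq : ∀ k, Wj z x k * Wj z x k = 1 := by
    intro k
    rw [Wj_sq, hx, mul_one, ← _root_.zpow_add, neg_add_cancel, _root_.zpow_zero]
  have hinv : ∀ k, (Wj z x k)⁻¹ = Wj z x k := fun k => inv_eq_of_mul_eq_one_left (hsq k)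
  have hxi : x⁻¹ = x := inv_eq_of_mul_eq_one_left hx
  have hcomm : ∀ i j : ℕ, i < j + n → j < i + n → Commute (Wj z x i) (Wj z x j) := by
    intro i j h1 h2
    rcases lt_trichotomy i j with h | h | h
    · apply Commute.symm
      apply Wj_comm_shift
      have := hcm (j - i) (by omega) (by omega)
      rwa [Nat.cast_sub h.le] at this
    · subst h; exact Commute.refl _
    · apply Wj_comm_shift
      have := hcm (i - j) (by omega) (by omega)
      rwa [Nat.cast_sub h.le] at this
  let S : ℕ → Set H := fun m => (fun j : ℕ => Wj z x j) '' Set.Ioo 0 m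
  have key : ∀ m : ℕ, 1 ≤ m → m ≤ n → ∃ M ∈ Subgroup.closure (S m),
      zseq z x m = Wj z x m * M * x := by
    intro m hm
    induction m, hm using Nat.le_induction with
    | base =>
      intro _
      refine ⟨1, one_mem _, ?_⟩
      have := Wj_conj1 z x 0
      rw [Wj_zero, zero_add] at this
      rw [Nat.cast_one, ← this, mul_one]
      simp only [zseq, br, hxi]
    | succ m hm ih =>
      intro hmn
      obtain ⟨M, hM, e⟩ := ih (by omega)
      have hM' : z⁻¹ * M * z ∈ Subgroup.closure (S (m + 1)) := by
        have : Subgroup.closure (S m) ≤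
            (Subgroup.closure (S (m+1))).comap (MulAut.conj z⁻¹).toMonoidHom := by
          rw [Subgroup.closure_le]
          rintro _ ⟨j, hj, rfl⟩
          have e2 : MulAut.conj z⁻¹ (Wj z x j) = Wj z x ((j + 1 : ℕ) : ℤ) := by
            rw [MulAut.conj_apply, inv_inv, Wj_conj1]
            push_cast
            rfl
          change MulAut.conj z⁻¹ (Wj z x j) ∈ Subgroup.closure (S (m+1))
          rw [e2]
          apply Subgroup.subset_closure
          exact ⟨j + 1, ⟨by omega, by have := hj.2; omega⟩, rfl⟩
        have := this hM
        change MulAut.conj z⁻¹ M ∈ Subgroup.closure (S (m+1)) at this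
        rwa [MulAut.conj_apply, inv_inv] at this
      have hWm : Wj z x m ∈ Subgroup.closure (S (m+1)) :=
        Subgroup.subset_closure ⟨m, ⟨by omega, by omega⟩, rfl⟩
      have hMm : M ∈ Subgroup.closure (S (m+1)) := by
        refine Subgroup.closure_mono ?_ hM
        rintro _ ⟨j, hj, rfl⟩
        exact ⟨j, ⟨hj.1, by have := hj.2; omega⟩, rfl⟩
      have hS : ∀ a ∈ S (m+1), ∀ b ∈ S (m+1), Commute a b := by
        rintro _ ⟨i, hi, rfl⟩ _ ⟨j, hj, rfl⟩
        have := hi.1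
        have := hi.2
        have := hj.1
        have := hj.2
        exact hcomm i j (by omega) (by omega)
      have hxM : Commute (z⁻¹ * (M * x) * z) (Wj z x ((m + 1 : ℕ) : ℤ)) := by
        have h1 : z⁻¹ * (M * x) * z ∈ Subgroup.closure (S (m+1)) := by
          have : z⁻¹ * (M * x) * z = (z⁻¹ * M * z) * Wj z x ((1 : ℕ) : ℤ) := by
            have := Wj_conj1 z x 0
            rw [Wj_zero, zero_add] at this
            rw [Nat.cast_one, ← this]
            group
          rw [this]
          refine mul_mem hM' (Subgroup.subset_closure ⟨1, ⟨by omega, by omega⟩, rfl⟩)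
        refine comm_closure (S := S (m+1)) (S' := {Wj z x ((m + 1 : ℕ) : ℤ)}) ?_ h1
          (Subgroup.subset_closure rfl)
        rintro _ ⟨i, hi, rfl⟩ _ rfl
        have := hi.1
        have := hi.2
        exact hcomm i (m+1) (by omega) (by omega)
      refine ⟨(z⁻¹ * (M * x) * z)⁻¹ * Wj z x m * M, ?_, ?_⟩
      · refine mul_mem (mul_mem (inv_mem ?_) hWm) hMm
        have : z⁻¹ * (M * x) * z = (z⁻¹ * M * z) * Wj z x ((1 : ℕ) : ℤ) := by
          have := Wj_conj1 z x 0
          rw [Wj_zero, zero_add] at this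
          rw [Nat.cast_one, ← this]
          group
        rw [this]
        refine mul_mem hM' (Subgroup.subset_closure ⟨1, ⟨by omega, by omega⟩, rfl⟩)
      · have e3 : z⁻¹ * (zseq z x m)⁻¹ * z = Wj z x ((m + 1 : ℕ) : ℤ) * (z⁻¹ * (M * x) * z)⁻¹ := by
          have : z⁻¹ * (zseq z x m)⁻¹ * z = (Wj z x ((m + 1 : ℕ) : ℤ) * (z⁻¹ * (M * x) * z))⁻¹ := by
            have h4 := Wj_conj1 z x m
            push_cast
            rw [← h4, e]
            group
          rw [this, ← hxM.eq, _root_.mul_inv_rev, hinv]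
        change z⁻¹ * (zseq z x m)⁻¹ * z * zseq z x m = _
        rw [e3, e]
        simp only [mul_assoc]
  obtain ⟨M, hM, e⟩ := key n hn le_rfl
  have hS : ∀ a ∈ S n, ∀ b ∈ S n, Commute a b := by
    rintro _ ⟨i, hi, rfl⟩ _ ⟨j, hj, rfl⟩
    have := hi.1
    have := hi.2
    have := hj.1
    have := hj.2
    exact hcomm i j (by omega) (by omega)
  have hMM : M * M = 1 := by
    refine invol_closure hS ?_ hM
    rintro _ ⟨i, hi, rfl⟩
    exact hsq i
  have c1 : Commute M (Wj z x n) := by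
    refine comm_closure (S := S n) (S' := {Wj z x n}) ?_ hM (Subgroup.subset_closure rfl)
    rintro _ ⟨i, hi, rfl⟩ _ rfl
    have := hi.1
    have := hi.2
    exact hcomm i n (by omega) (by omega)
  have c2 : Commute M x := by
    refine comm_closure (S := S n) (S' := {x}) ?_ hM (Subgroup.subset_closure rfl)
    rintro _ ⟨i, hi, rfl⟩ _ rfl
    have h := hcm i hi.1 hi.2
    exact h
  rw [e]
  have c3 : Commute M (Wj z x n * x) := c1.mul_right c2
  calc Wj z x n * M * x * (Wj z x n * M * x)
      = Wj z x n * x * M * (Wj z x n * x * M) := by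
        rw [mul_assoc (Wj z x n) M x, c2.eq]; simp only [mul_assoc]
    _ = Wj z x n * x * (M * (Wj z x n * x)) * M := by simp only [mul_assoc]
    _ = Wj z x n * x * (Wj z x n * x) * (M * M) := by rw [c3.eq]; simp only [mul_assoc]
    _ = _ := by rw [hMM, mul_one]

/-- central involutions -/
def CI (H : Type*) [Group H] : Subgroup H where
  carrier := {g | g ∈ Subgroup.center H ∧ g * g = 1}
  one_mem' := ⟨one_mem _, one_mul 1⟩
  mul_mem' := by
    rintro a b ⟨ha, ha'⟩ ⟨hb, hb'⟩
    refine ⟨mul_mem ha hb, ?_⟩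
    have := Subgroup.mem_center_iff.1 ha b
    rw [mul_assoc, ← mul_assoc b a b, this, mul_assoc a b b, hb', mul_one, ha']
  inv_mem' := by
    rintro a ⟨ha, ha'⟩
    exact ⟨inv_mem ha, by rw [← _root_.mul_inv_rev, ha', inv_one]⟩

instance CI_normal : (CI H).Normal := ⟨by
  intro n hn g
  have := Subgroup.mem_center_iff.1 hn.1 g
  rwa [this, mul_inv_cancel_right]⟩

lemma map_Wj {H' : Type*} [Group H'] (φ : H →* H') (z x : H) (k : ℤ) :
    φ (Wj z x k) = Wj (φ z) (φ x) k := by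
  simp only [Wj, map_mul, map_zpow]

lemma map_zseq {H' : Type*} [Group H'] (φ : H →* H') (z x : H) (k : ℕ) :
    φ (zseq z x k) = zseq (φ z) (φ x) k := by
  induction k with
  | zero => rfl
  | succ n ih => simp only [zseq, br, map_mul, map_inv, ih]

lemma mem_center_of_gen {z x : H} (hg : Subgroup.closure {z, x} = ⊤) {g : H}
    (h1 : Commute g z) (h2 : Commute g x) : g ∈ Subgroup.center H := by
  rw [Subgroup.mem_center_iff]
  intro h
  have : Subgroup.closure {z, x} ≤ Subgroup.centralizer {g} := by
    rw [Subgroup.closure_le]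
    rintro a (rfl | rfl)
    · exact Subgroup.mem_centralizer_singleton_iff.2 h1.symm
    · exact Subgroup.mem_centralizer_singleton_iff.2 h2.symm
  rw [hg] at this
  exact Subgroup.mem_centralizer_singleton_iff.1 (this (Subgroup.mem_top h))

lemma step1_gen (z x : H) (hg : Subgroup.closure {z, x} = ⊤)
    (h4 : ∀ i, zseq z x i * zseq z x i * (zseq z x i * zseq z x i) = 1)
    (hc : ∀ i, Commute (zseq z x i * zseq z x i) z) :
    x * x ∈ CI H ∧ ∀ n : ℕ, ⁅Wj z x n, x⁆ ∈ CI H := by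
  have hq : x * x ∈ CI H := by
    refine ⟨mem_center_of_gen hg (hc 0) ?_, h4 0⟩
    change x * x * x = x * (x * x)
    rw [mul_assoc]
  refine ⟨hq, ?_⟩
  intro n
  induction n using Nat.strong_induction_on with
  | _ n ih =>
    rcases Nat.eq_zero_or_pos n with h0 | hpos
    · subst h0
      rw [Nat.cast_zero, Wj_zero, commutatorElement_self]
      exact one_mem _
    let φ := QuotientGroup.mk' (CI H)
    have hφ : ∀ g, φ g = 1 ↔ g ∈ CI H := fun g => QuotientGroup.eq_one_iff g
    have hqx : φ x * φ x = 1 := by rw [← map_mul]; exact (hφ _).2 hq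
    have main := zseq_sq (φ z) (φ x) n hpos hqx (by
      intro k hk hkn
      have := (hφ _).2 (ih k hkn)
      rw [map_commutatorElement, map_Wj] at this
      exact commutatorElement_eq_one_iff_commute.1 this)
    have hWsq : φ (Wj z x n) * φ (Wj z x n) = 1 := by
      rw [map_Wj, Wj_sq, hqx, mul_one, ← _root_.zpow_add, neg_add_cancel, _root_.zpow_zero]
    have main2 : φ (zseq z x n * zseq z x n) = φ ⁅Wj z x n, x⁆ := by
      rw [map_mul, map_zseq, main, map_commutatorElement, commutatorElement_def, ← map_Wj,
        inv_eq_of_mul_eq_one_left hWsq, inv_eq_of_mul_eq_one_left hqx]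
      simp only [mul_assoc]
    have hm : (zseq z x n * zseq z x n)⁻¹ * ⁅Wj z x n, x⁆ ∈ CI H := by
      rw [← hφ, map_mul, map_inv, main2, inv_mul_cancel]
    obtain ⟨a, ha, ea⟩ : ∃ a ∈ CI H, ⁅Wj z x n, x⁆ = zseq z x n * zseq z x n * a :=
      ⟨_, hm, by rw [mul_inv_cancel_left]⟩
    have hac : ∀ g, Commute a g := fun g => (Subgroup.mem_center_iff.1 ha.1 g).symm
    have hcz : Commute ⁅Wj z x n, x⁆ z := by
      rw [ea]
      exact (hc n).mul_left (hac z)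
    have hsq : ⁅Wj z x n, x⁆ * ⁅Wj z x n, x⁆ = 1 := by
      rw [ea, mul_assoc, ← mul_assoc a, (hac _).eq, mul_assoc _ a a, ha.2, mul_one, h4]
    have hcx : Commute ⁅Wj z x n, x⁆ x := by
      have hq' : ∀ g, Commute (x * x) g := fun g => (Subgroup.mem_center_iff.1 hq.1 g).symm
      have e1 : x * ⁅Wj z x n, x⁆ * x⁻¹ = ⁅Wj z x n, x⁆⁻¹ := by
        rw [commutatorElement_inv, commutatorElement_def, commutatorElement_def]
        generalize Wj z x n = w
        have : x * x * x⁻¹ * (x * x)⁻¹ = x⁻¹ := by group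
        calc x * (w * x * w⁻¹ * x⁻¹) * x⁻¹ = x * w * x * w⁻¹ * (x * x)⁻¹ := by group
          _ = x * w * x⁻¹ * ((x * x) * (w⁻¹ * (x * x)⁻¹)) := by group
          _ = x * w * x⁻¹ * (w⁻¹ * (x * x)⁻¹ * (x * x)) := by rw [(hq' _).eq]
          _ = _ := by group
      rw [inv_eq_of_mul_eq_one_left hsq] at e1
      exact (mul_inv_eq_iff_eq_mul.1 e1).symm
    exact ⟨mem_center_of_gen hg hcz hcx, hsq⟩

/-- version without the generation hypothesis -/
lemma step1 (z x : H)
    (h4 : ∀ i, zseq z x i * zseq z x i * (zseq z x i * zseq z x i) = 1)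
    (hc : ∀ i, Commute (zseq z x i * zseq z x i) z) :
    (Commute (x * x) z ∧ Commute (x * x) x ∧ x * x * (x * x) = 1) ∧
    ∀ n : ℕ, Commute ⁅Wj z x n, x⁆ z ∧ Commute ⁅Wj z x n, x⁆ x ∧
      ⁅Wj z x n, x⁆ * ⁅Wj z x n, x⁆ = 1 := by
  let K := Subgroup.closure {z, x}
  let z' : K := ⟨z, Subgroup.subset_closure (Or.inl rfl)⟩
  let x' : K := ⟨x, Subgroup.subset_closure (Or.inr rfl)⟩
  have hz : K.subtype z' = z := rfl
  have hx : K.subtype x' = x := rfl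
  have hinj := K.subtype_injective
  have hg : Subgroup.closure {z', x'} = ⊤ := by
    have := Subgroup.closure_closure_coe_preimage (k := {z, x})
    rw [← this]
    congr 1
    ext ⟨g, hg⟩
    simp [z', x']
  have := step1_gen z' x' hg
    (by intro i; apply hinj; simp only [map_mul, map_zseq, hz, hx, map_one]; exact h4 i)
    (by
      intro i
      apply hinj
      simp only [map_mul, map_zseq, hz, hx]; exact hc i)
  have tr : ∀ g : K, g ∈ CI K → Commute (g : H) z ∧ Commute (g : H) x ∧ (g : H) * g = 1 := by
    intro g hg
    have a1 := Subgroup.mem_center_iff.1 hg.1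
    refine ⟨?_, ?_, ?_⟩
    · exact (congrArg K.subtype (a1 z')).symm
    · exact (congrArg K.subtype (a1 x')).symm
    · exact congrArg K.subtype hg.2
  refine ⟨tr _ this.1, fun n => ?_⟩
  have h := tr _ (this.2 n)
  have e : ((⁅Wj z' x' n, x'⁆ : K) : H) = ⁅Wj z x n, x⁆ := by
    rw [← Subgroup.subtype_apply, map_commutatorElement, map_Wj]
    rfl
  rwa [e] at h

lemma comm_list {ι : Type*} (v : ι → H) {c : H} (hC : ∀ i, Commute c (v i)) (l : List ι) :
    Commute c (l.map v).prod := by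
  induction l with
  | nil => simp
  | cons i l ih =>
    rw [List.map_cons, List.prod_cons]
    exact (hC i).mul_right ih

/-- Normal forms: products of elements commuting modulo `C`, of order two modulo `C`. -/
lemma prod_perm {ι : Type*} (v : ι → H) (C : Subgroup H) (hC : ∀ c ∈ C, ∀ i, Commute c (v i))
    (hcm : ∀ i j, ∃ c ∈ C, v i * v j = v j * v i * c) {l l' : List ι} (h : l.Perm l') :
    ∃ c ∈ C, (l.map v).prod = (l'.map v).prod * c := by
  induction h with
  | nil => exact ⟨1, one_mem _, by simp⟩
  | cons i h ih =>
    obtain ⟨c, hc, e⟩ := ih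
    exact ⟨c, hc, by rw [List.map_cons, List.prod_cons, e, List.map_cons, List.prod_cons, mul_assoc]⟩
  | swap i j l =>
    obtain ⟨c, hc, e⟩ := hcm j i
    refine ⟨c, hc, ?_⟩
    simp only [List.map_cons, List.prod_cons]
    rw [← mul_assoc, e, mul_assoc _ c, (comm_list v (hC c hc) l).eq]
    simp only [mul_assoc]
  | trans h1 h2 ih1 ih2 =>
    obtain ⟨c, hc, e⟩ := ih1
    obtain ⟨c', hc', e'⟩ := ih2
    exact ⟨c' * c, mul_mem hc' hc, by rw [e, e', mul_assoc]⟩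

lemma normal_form {ι : Type*} (v : ι → H) (C : Subgroup H) (hC : ∀ c ∈ C, ∀ i, Commute c (v i))
    (hsq : ∀ i, v i * v i ∈ C) (hcm : ∀ i j, ∃ c ∈ C, v i * v j = v j * v i * c)
    {y : H} (hy : y ∈ Subgroup.closure (Set.range v)) :
    ∃ l : List ι, l.Nodup ∧ ∃ c ∈ C, y = (l.map v).prod * c := by
  classical
  have hstep : ∀ (l : List ι) (j : ι), l.Nodup →
      ∃ l' : List ι, l'.Nodup ∧ ∃ c ∈ C, (l.map v).prod * v j = (l'.map v).prod * c := by
    intro l j hl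
    obtain ⟨c, hc, e⟩ := prod_perm v C hC hcm (l := l ++ [j]) (l' := j :: l)
      (List.perm_append_comm (l₁ := l) (l₂ := [j]))
    rw [List.map_append, List.prod_append] at e
    simp only [List.map_cons, List.map_nil, List.prod_cons, List.prod_nil, mul_one] at e
    by_cases hj : j ∈ l
    · obtain ⟨c', hc', e'⟩ := prod_perm v C hC hcm (List.perm_cons_erase hj)
      refine ⟨l.erase j, hl.erase j, (v j * v j) * c' * c, mul_mem (mul_mem (hsq j) hc') hc, ?_⟩
      have hcc : Commute (v j * v j) ((l.erase j).map v).prod :=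
        comm_list v (hC _ (hsq j)) _
      rw [e, e', List.map_cons, List.prod_cons]
      calc v j * (v j * ((l.erase j).map v).prod * c') * c
          = (v j * v j) * ((l.erase j).map v).prod * c' * c := by simp only [mul_assoc]
        _ = _ := by rw [hcc.eq]; simp only [mul_assoc]
    · exact ⟨j :: l, List.nodup_cons.2 ⟨hj, hl⟩, c, hc, by rw [e]; simp⟩
  induction hy using Subgroup.closure_induction_right with
  | one => exact ⟨[], List.nodup_nil, 1, one_mem _, by simp⟩
  | mul_right y hy w hw ih =>
    obtain ⟨j, rfl⟩ := hw
    obtain ⟨l, hl, c, hc, e⟩ := ih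
    obtain ⟨l', hl', c', hc', e'⟩ := hstep l j hl
    refine ⟨l', hl', c' * c, mul_mem hc' hc, ?_⟩
    rw [e, mul_assoc, (hC c hc j).eq, ← mul_assoc, e', mul_assoc]
  | mul_inv_cancel y hy w hw ih =>
    obtain ⟨j, rfl⟩ := hw
    obtain ⟨l, hl, c, hc, e⟩ := ih
    obtain ⟨l', hl', c', hc', e'⟩ := hstep l j hl
    refine ⟨l', hl', c' * c * (v j * v j)⁻¹, mul_mem (mul_mem hc' hc) (inv_mem (hsq j)), ?_⟩
    have : (v j)⁻¹ = v j * (v j * v j)⁻¹ := by group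
    rw [e, this, mul_assoc, ← mul_assoc c, (hC c hc j).eq, mul_assoc (v j), ← mul_assoc, e']
    simp only [mul_assoc]

end Abs

/-! ### Unipotent elements -/

section Unip
open scoped commutatorElement

def UM (p r : R2) : Matrix (Fin 3) (Fin 3) R2 := !![1, p, r; 0, 1, (1 + T 1) * bar p; 0, 0, 1]

def IsU (g : FF) (p r : R2) : Prop := (rho g).val = UM p r

lemma UM_mul (p r p' r' : R2) :
    UM p r * UM p' r' = UM (p + p') (r' + p * ((1 + T 1) * bar p') + r) := by
  rw [UM, UM, UM, Matrix.mul_fin_three, bar_add]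
  refine mat3_ext ?_ ?_ ?_ ?_ ?_ ?_ ?_ ?_ ?_ <;> ring

lemma UM_zero : UM 0 0 = 1 := by
  rw [UM, bar_zero, mul_zero, Matrix.one_fin_three]

lemma UM_inj {p r p' r' : R2} (h : UM p r = UM p' r') : p = p' ∧ r = r' := by
  have h1 := congrFun (congrFun h 0) 1
  have h2 := congrFun (congrFun h 0) 2
  simp [UM] at h1 h2
  exact ⟨h1, h2⟩

lemma IsU.mul {g h : FF} {p r p' r' : R2} (hg : IsU g p r) (hh : IsU h p' r') :
    IsU (g * h) (p + p') (r' + p * ((1 + T 1) * bar p') + r) := by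
  rw [IsU, rho_mul, hg, hh, UM_mul]

lemma IsU_one : IsU 1 0 0 := by rw [IsU, rho_one, UM_zero]

lemma self_add (p : R2) : p + p = 0 := CharTwo.add_self_eq_zero p

lemma IsU.inv {g : FF} {p r : R2} (hg : IsU g p r) : IsU g⁻¹ p (r + p * ((1 + T 1) * bar p)) := by
  have h1 : (rho g).val * UM p (r + p * ((1 + T 1) * bar p)) = 1 := by
    rw [hg, UM_mul, self_add, ← UM_zero]
    congr 1
    have := two_eq
    grind
  have h2 : (rho g⁻¹).val * (rho g).val = 1 := by
    rw [← rho_mul, inv_mul_cancel, rho_one]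
  rw [IsU]
  calc (rho g⁻¹).val = (rho g⁻¹).val * ((rho g).val * UM p (r + p * ((1 + T 1) * bar p))) := by
        rw [h1, mul_one]
    _ = _ := by rw [← mul_assoc, h2, one_mul]

lemma IsU.unique {g : FF} {p r p' r' : R2} (h : IsU g p r) (h' : IsU g p' r') :
    p = p' ∧ r = r' := UM_inj (h.symm.trans h')

lemma IsU_x : IsU gx 1 (T 1) := by
  rw [IsU, rho_x, XrM, UM, bar_one, mul_one]

lemma IsU.conjD {g : FF} {p r : R2} (hg : IsU g p r) (k : ℤ) :
    IsU (gD ^ (-k) * g * gD ^ k) (T (-k) * p) r := by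
  have hT : (T k : R2) * T (-k) = 1 := by rw [← T_add, add_neg_cancel, T_zero]
  rw [IsU, rho_mul, rho_mul, hg, rho_Dz, rho_Dz, UM, UM, Matrix.mul_fin_three,
    Matrix.mul_fin_three, bar_mul, bar_T, neg_neg]
  refine mat3_ext ?_ ?_ ?_ ?_ ?_ ?_ ?_ ?_ ?_ <;> grind

lemma IsU.comm {g h : FF} {p r p' r' : R2} (hg : IsU g p r) (hh : IsU h p' r') :
    IsU ⁅g, h⁆ 0 ((1 + T 1) * (p * bar p' + p' * bar p)) := by
  have := ((hg.mul hh).mul hg.inv).mul hh.inv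
  rw [← commutatorElement_def] at this
  convert this using 1
  · have := two_eq
    grind
  · have := two_eq
    grind

lemma IsU.sq {g : FF} {p r : R2} (hg : IsU g p r) : IsU (g * g) 0 ((1 + T 1) * (p * bar p)) := by
  have := hg.mul hg
  convert this using 1
  · exact (self_add p).symm
  · have := two_eq
    grind

lemma gz_eq : gz = gD * gx⁻¹ := by rw [gD_eq, mul_inv_cancel_right]

lemma IsU.conj {g h : FF} {p r p' r' : R2} (hg : IsU g p r) (hh : IsU h p' r') :
    IsU (h * g * h⁻¹) p (r + (1 + T 1) * (p * bar p' + p' * bar p)) := by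
  have := (hh.mul hg).mul hh.inv
  convert this using 1
  · have := two_eq
    grind
  · have := two_eq
    grind

lemma IsU.conjz {g : FF} {p r : R2} (hg : IsU g p r) :
    IsU (gz⁻¹ * g * gz) (T (-1) * p) (r + (1 + T 1) * (T (-1) * p + bar (T (-1) * p))) := by
  have := (hg.conjD 1).conj IsU_x
  rw [bar_one, mul_one, one_mul] at this
  have e : gz⁻¹ * g * gz = gx * (gD ^ (-1 : ℤ) * g * gD ^ (1 : ℤ)) * gx⁻¹ := by
    rw [gz_eq]; group
  rwa [e]

lemma IsU.conjzi {g : FF} {p r : R2} (hg : IsU g p r) :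
    IsU (gz * g * gz⁻¹) (T 1 * p) (r + (1 + T 1) * (p + bar p)) := by
  have := (hg.conj IsU_x.inv).conjD (-1)
  rw [bar_one, mul_one, one_mul, neg_neg] at this
  have e : gz * g * gz⁻¹ = gD ^ (1 : ℤ) * (gx⁻¹ * g * gx⁻¹⁻¹) * gD ^ (-1 : ℤ) := by
    rw [gz_eq]; group
  rwa [e]

lemma IsU_w (k : ℤ) : ∃ r, IsU (Wj gz gx k) (T (-k)) r := by
  induction k using Int.induction_on with
  | zero =>
    refine ⟨T 1, ?_⟩
    rw [Wj_zero, neg_zero, T_zero]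
    exact IsU_x
  | succ n ih =>
    obtain ⟨r, hr⟩ := ih
    refine ⟨r + (1 + T 1) * (T (-1) * T (-n) + bar (T (-1) * T (-n))), ?_⟩
    have := hr.conjz
    rw [Wj_conj1] at this
    have e : (T (-((n : ℤ) + 1)) : R2) = T (-1) * T (-n) := by rw [← T_add]; congr 1; ring
    rwa [e]
  | pred n ih =>
    obtain ⟨r, hr⟩ := ih
    refine ⟨r + (1 + T 1) * (T (- -(n : ℤ)) + bar (T (- -(n : ℤ)))), ?_⟩
    have := hr.conjzi
    have e2 : gz * Wj gz gx (-n) * gz⁻¹ = Wj gz gx (-n - 1) := by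
      rw [← sub_add_cancel (-(n : ℤ)) 1, ← Wj_conj1]
      simp only [add_sub_cancel_right]
      group
    rw [e2] at this
    have e : (T (-(-(n : ℤ) - 1)) : R2) = T 1 * T (- -(n : ℤ)) := by rw [← T_add]; congr 1; ring
    rwa [e]

lemma IsU_zseq (i : ℕ) : ∃ p r, IsU (zseq gz gx i) p r := by
  induction i with
  | zero => exact ⟨_, _, IsU_x⟩
  | succ n ih =>
    obtain ⟨p, r, h⟩ := ih
    exact ⟨_, _, (h.inv.conjz).mul h⟩

lemma xseq_eq (i : ℕ) : xseq gx gy i = zseq gz gx i := by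
  induction i with
  | zero => rfl
  | succ n ih => rw [xseq, zseq, ih]; rfl

/-- The normal closure of the relators. -/
def NN : Subgroup FF := Subgroup.normalClosure q42Rels

instance : NN.Normal := Subgroup.normalClosure_normal

lemma rho_y3 : (rho (gy ^ 3)).val = Matrix.scalar (Fin 3) (T 1 : R2) := by
  rw [pow_succ, pow_two, rho_mul, rho_mul, rho_y, YrM, Matrix.mul_fin_three, Matrix.mul_fin_three]
  have : Matrix.scalar (Fin 3) (T 1 : R2) = !![T 1, 0, 0; 0, T 1, 0; 0, 0, T 1] := by
    ext1 i j
    fin_cases i <;> fin_cases j <;> simp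
  rw [this]
  have := two_eq
  refine mat3_ext ?_ ?_ ?_ ?_ ?_ ?_ ?_ ?_ ?_ <;> grind

lemma scalar_of_one {g : FF} (h : (rho g).val = 1) :
    ∃ r : R2, (rho g).val = Matrix.scalar (Fin 3) r := ⟨1, by rw [h, map_one]⟩

lemma pow4 {G : Type*} [Group G] (a : G) : a ^ 4 = a * a * (a * a) := by
  rw [show 4 = 2 + 2 from rfl, pow_add, pow_two]

lemma NN_le : NN ≤ (FreeGroup.lift ![pp X, pp Y]).ker := by
  apply Subgroup.normalClosure_le_normal
  intro g hg
  change g ∈ (FreeGroup.lift ![pp X, pp Y]).ker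
  rw [MonoidHom.mem_ker, lift_eq, pp_eq_one_iff]
  rcases hg with (hg | ⟨i, hg⟩) | ⟨i, hg⟩
  · have : g = gy ^ 3 := hg
    rw [this]
    exact ⟨_, rho_y3⟩
  · apply scalar_of_one
    have e : g = zseq gz gx i * zseq gz gx i * (zseq gz gx i * zseq gz gx i) := by
      rw [hg, ← xseq_eq]
      exact pow4 _
    obtain ⟨p, r, h⟩ := IsU_zseq i
    have := h.sq.sq
    rw [zero_mul, mul_zero, ← e, IsU, UM_zero] at this
    exact this
  · apply scalar_of_one
    have e : g = (zseq gz gx i * zseq gz gx i)⁻¹ *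
        (gz⁻¹ * (zseq gz gx i * zseq gz gx i) * gz) := by
      rw [hg, ← xseq_eq]
      change br (xseq gx gy i ^ 2) gz = _
      rw [br, pow_two]
      simp only [mul_assoc]
    obtain ⟨p, r, h⟩ := IsU_zseq i
    have h2 := h.sq
    have := h2.inv.mul h2.conjz
    rw [← e, IsU, bar_zero, mul_zero, mul_zero, mul_zero, add_zero, bar_zero, add_zero, mul_zero,
      add_zero, mul_zero, add_zero, self_add, UM_zero] at this
    exact this

lemma NN_scalar {n : FF} (hn : n ∈ NN) : ∃ r : R2, (rho n).val = Matrix.scalar (Fin 3) r := by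
  have := NN_le hn
  rwa [MonoidHom.mem_ker, lift_eq, pp_eq_one_iff] at this

lemma unit_eq_T {s s' : R2} (h : s * s' = 1) : ∃ k : ℤ, s = T k := by
  have hs : s ≠ 0 := by rintro rfl; rw [zero_mul] at h; exact zero_ne_one h
  have hs' : s' ≠ 0 := by rintro rfl; rw [mul_zero] at h; exact zero_ne_one h
  obtain ⟨l, u, e⟩ := exists_Ex hs
  obtain ⟨l', u', e'⟩ := exists_Ex hs'
  have h1 := e.mul e'
  rw [h] at h1
  have h2 := h1.unique Ex_one
  have h3 := e.le
  have h4 := e'.le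
  have h5 : l = u := by omega
  subst h5
  refine ⟨l, ?_⟩
  ext k
  by_cases hk : k = l
  · subst hk
    rw [e.2.1, (Ex_T k).2.1]
  · rw [e.1.zero_of (by omega), (Ex_T l).1.zero_of (by omega)]

lemma NN_T {n : FF} (hn : n ∈ NN) : ∃ k : ℤ, (rho n).val = Matrix.scalar (Fin 3) (T k : R2) := by
  obtain ⟨s, hs⟩ := NN_scalar hn
  obtain ⟨s', hs'⟩ := NN_scalar (inv_mem hn)
  have h : (rho n).val * (rho n⁻¹).val = 1 := by rw [← rho_mul, mul_inv_cancel, rho_one]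
  rw [hs, hs', ← map_mul] at h
  have h0 := congrFun (congrFun h 0) 0
  simp at h0
  obtain ⟨k, rfl⟩ := unit_eq_T h0
  exact ⟨k, hs⟩

lemma st_N {n : FF} (hn : n ∈ NN) : ∃ k : ℤ, ∀ g, sa (g * n) = T k * sa g ∧
    sb (g * n) = T k * sb g ∧ sc (g * n) = T k * sc g := by
  obtain ⟨k, hk⟩ := NN_T hn
  refine ⟨k, fun g => ?_⟩
  obtain ⟨h1, h2, h3⟩ := state_mul g n _ hk
  simp at h1 h2 h3
  exact ⟨h1.trans (mul_comm _ _), h2.trans (mul_comm _ _), h3.trans (mul_comm _ _)⟩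

lemma st_U {u : FF} {p r : R2} (hu : IsU u p r) (g : FF) :
    sa (g * u) = sa g + (1 + T 1) * bar p * sb g + r * sc g ∧
    sb (g * u) = sb g + p * sc g ∧ sc (g * u) = sc g := by
  obtain ⟨h1, h2, h3⟩ := state_mul g u _ hu
  simp [UM] at h1 h2 h3
  refine ⟨?_, ?_, h3⟩
  · rw [h1]; ring
  · rw [h2]; ring

/-- unipotents equal modulo `NN` have the same parameters -/
lemma IsU.congr {u u' : FF} {p r p' r' : R2} (hu : IsU u p r) (hu' : IsU u' p' r')
    (h : u⁻¹ * u' ∈ NN) : p = p' ∧ r = r' := by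
  obtain ⟨k, hk⟩ := NN_T h
  have h1 := hu.inv.mul hu'
  rw [IsU, hk] at h1
  have h0 := congrFun (congrFun h1 0) 0
  simp [UM] at h0
  rw [h0, map_one, ← UM_zero] at h1
  have h2 := UM_inj h1
  have h3 : p = p' := by have := two_eq; grind
  subst h3
  refine ⟨rfl, ?_⟩
  have := two_eq
  grind

/-- central elements -/
def dF : ℕ → FF
  | 0 => gx * gx
  | k + 1 => ⁅Wj gz gx ((k + 1 : ℕ) : ℤ), gx⁆

def ee : ℕ → R2
  | 0 => 1
  | k + 1 => T (((k + 1 : ℕ) : ℤ)) + T (-((k + 1 : ℕ) : ℤ))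

lemma IsU_d (k : ℕ) : IsU (dF k) 0 ((1 + T 1) * ee k) := by
  cases k with
  | zero =>
    have := IsU_x.sq
    rwa [bar_one, mul_one] at this
  | succ k =>
    obtain ⟨r, hr⟩ := IsU_w ((k + 1 : ℕ) : ℤ)
    have := hr.comm IsU_x
    rw [bar_one, mul_one, one_mul, bar_T, neg_neg, add_comm (T _) (T _)] at this
    exact this

lemma coeff_T (k m : ℤ) : (T k : R2).coeff m = if k = m then 1 else 0 := T_apply m k

lemma coeff_ee (k m : ℕ) : (ee k).coeff m = if k = m then 1 else 0 := by
  cases k with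
  | zero =>
    rw [ee, ← T_zero, coeff_T]
    by_cases h : 0 = m
    · subst h; simp
    · rw [if_neg (by omega), if_neg h]
  | succ k =>
    rw [ee, coeff_add', coeff_T, coeff_T, if_neg (c := (-((k + 1 : ℕ) : ℤ) = m)) (by omega), add_zero]
    by_cases h : k + 1 = m
    · subst h; simp
    · rw [if_neg (by omega), if_neg h]

abbrev GG : Type := FF ⧸ NN
def pi : FF →* GG := QuotientGroup.mk' NN

lemma pi_eq_one (g : FF) : pi g = 1 ↔ g ∈ NN := QuotientGroup.eq_one_iff g

lemma pi_eq {g h : FF} : pi g = pi h ↔ g⁻¹ * h ∈ NN := QuotientGroup.eq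

lemma pi_d (k : ℕ) : Commute (pi (dF k)) (pi gz) ∧ Commute (pi (dF k)) (pi gx) ∧
    pi (dF k) * pi (dF k) = 1 := by
  have h := step1 (pi gz) (pi gx) (by
    intro i
    rw [← map_zseq, ← xseq_eq, ← map_mul, ← map_mul, pi_eq_one]
    apply Subgroup.subset_normalClosure
    refine Or.inl (Or.inr ⟨i, ?_⟩)
    exact (pow4 _).symm) (by
    intro i
    rw [← map_zseq, ← xseq_eq, ← map_mul]
    have : br (xseq gx gy i ^ 2) gz ∈ NN := Subgroup.subset_normalClosure (Or.inr ⟨i, rfl⟩)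
    rw [← pi_eq_one, br, pow_two] at this
    simp only [map_mul, map_inv] at this
    simp only [map_mul]
    generalize pi (xseq gx gy i) * pi (xseq gx gy i) = a at *
    generalize pi gz = b at *
    change a * b = b * a
    have h2 : a⁻¹ * b⁻¹ * a * b = (b * a)⁻¹ * (a * b) := by group
    rw [h2] at this
    exact (inv_mul_eq_one.1 this).symm)
  cases k with
  | zero => exact h.1
  | succ k =>
    have := h.2 (k + 1)
    rw [← map_Wj, ← map_commutatorElement] at this
    exact this

lemma commute_zx {c : GG} (h1 : Commute c (pi gz)) (h2 : Commute c (pi gx)) (k : ℤ) :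
    Commute c (pi (Wj gz gx k)) := by
  rw [map_Wj, Wj]
  exact ((h1.zpow_right _).mul_right h2).mul_right (h1.zpow_right _)

/-- subgroup of central elements of the image -/
def DD : Subgroup GG := Subgroup.closure (Set.range fun k => pi (dF k))

lemma DD_comm {c : GG} (hc : c ∈ DD) : Commute c (pi gz) ∧ Commute c (pi gx) := by
  constructor
  · refine comm_closure (S' := {pi gz}) ?_ hc (Subgroup.subset_closure rfl)
    rintro _ ⟨k, rfl⟩ _ rfl
    exact (pi_d k).1
  · refine comm_closure (S' := {pi gx}) ?_ hc (Subgroup.subset_closure rfl)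
    rintro _ ⟨k, rfl⟩ _ rfl
    exact (pi_d k).2.1

lemma DD_comm_w {c : GG} (hc : c ∈ DD) (k : ℤ) : Commute c (pi (Wj gz gx k)) :=
  commute_zx (DD_comm hc).1 (DD_comm hc).2 k

lemma d_mem (k : ℕ) : pi (dF k) ∈ DD := Subgroup.subset_closure ⟨k, rfl⟩

lemma w_sq (k : ℤ) : pi (Wj gz gx k) * pi (Wj gz gx k) ∈ DD := by
  have e : pi (Wj gz gx k) * pi (Wj gz gx k) = pi (dF 0) := by
    rw [map_Wj, Wj_sq]
    have h : Commute (pi (dF 0)) (pi gz ^ k) := (pi_d 0).1.zpow_right k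
    have e0 : pi gx * pi gx = pi (dF 0) := by rw [dF, map_mul]
    rw [e0, mul_assoc, h.eq, ← mul_assoc, ← _root_.zpow_add, neg_add_cancel, _root_.zpow_zero,
      one_mul]
  rw [e]
  exact d_mem 0

lemma w_comm_lt {i j : ℤ} (h : j < i) : ∃ c ∈ DD,
    pi (Wj gz gx i) * pi (Wj gz gx j) = pi (Wj gz gx j) * pi (Wj gz gx i) * c := by
  obtain ⟨k, hk⟩ : ∃ k : ℕ, i - j = ((k + 1 : ℕ) : ℤ) := ⟨(i - j - 1).toNat, by omega⟩
  refine ⟨pi (dF (k + 1)), d_mem _, ?_⟩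
  have h1 : Wj gz gx i = gz ^ (-j) * Wj gz gx (i - j) * gz ^ j := by
    rw [Wj_conj, sub_add_cancel]
  have h2 : Wj gz gx j = gz ^ (-j) * gx * gz ^ j := rfl
  have e1 : Wj gz gx i * Wj gz gx j
      = gz ^ (-j) * dF (k + 1) * gz ^ j * (Wj gz gx j * Wj gz gx i) := by
    rw [h1, h2, dF, ← hk, commutatorElement_def]
    generalize Wj gz gx (i - j) = w
    rw [_root_.zpow_neg]
    group
  have hc := (pi_d (k + 1)).1.zpow_right j
  have e2 : pi (gz ^ (-j) * dF (k + 1) * gz ^ j) = pi (dF (k + 1)) := by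
    simp only [map_mul, map_zpow]
    rw [mul_assoc, hc.eq, ← mul_assoc, ← _root_.zpow_add, neg_add_cancel, _root_.zpow_zero,
      one_mul]
  rw [← map_mul, e1, map_mul, e2, map_mul,
    ((DD_comm_w (d_mem (k+1)) j).mul_right (DD_comm_w (d_mem (k+1)) i)).eq]

lemma w_comm (i j : ℤ) : ∃ c ∈ DD,
    pi (Wj gz gx i) * pi (Wj gz gx j) = pi (Wj gz gx j) * pi (Wj gz gx i) * c := by
  rcases lt_trichotomy j i with h | h | h
  · exact w_comm_lt h
  · subst h
    exact ⟨1, one_mem _, by rw [mul_one]⟩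
  · obtain ⟨c, hc, e⟩ := w_comm_lt h
    exact ⟨c⁻¹, inv_mem hc, by rw [e, mul_inv_cancel_right]⟩

/-- The unipotent subgroup upstairs. -/
def UF : Subgroup FF := Subgroup.closure (Set.range fun k : ℤ => Wj gz gx k)

lemma UF_IsU {u : FF} (hu : u ∈ UF) : ∃ p r, IsU u p r := by
  induction hu using Subgroup.closure_induction with
  | mem a ha =>
    obtain ⟨k, rfl⟩ := ha
    obtain ⟨r, hr⟩ := IsU_w k
    exact ⟨_, r, hr⟩
  | one => exact ⟨_, _, IsU_one⟩
  | mul a b _ _ ha hb =>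
    obtain ⟨_, _, ha⟩ := ha
    obtain ⟨_, _, hb⟩ := hb
    exact ⟨_, _, ha.mul hb⟩
  | inv a _ ha =>
    obtain ⟨_, _, ha⟩ := ha
    exact ⟨_, _, ha.inv⟩

lemma IsU_list_w (l : List ℤ) :
    ∃ r, IsU (l.map fun k => Wj gz gx k).prod (l.map fun k => (T (-k) : R2)).sum r := by
  induction l with
  | nil => exact ⟨0, IsU_one⟩
  | cons k l ih =>
    obtain ⟨r, hr⟩ := ih
    obtain ⟨r', hr'⟩ := IsU_w k
    simp only [List.map_cons, List.prod_cons, List.sum_cons]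
    exact ⟨_, hr'.mul hr⟩

lemma IsU_list_d (l : List ℕ) :
    IsU (l.map dF).prod 0 ((1 + T 1) * (l.map ee).sum) := by
  induction l with
  | nil =>
    simp only [List.map_nil, List.prod_nil, List.sum_nil, mul_zero]
    exact IsU_one
  | cons k l ih =>
    simp only [List.map_cons, List.prod_cons, List.sum_cons]
    have := (IsU_d k).mul ih
    rw [add_zero, zero_mul, add_zero] at this
    rwa [mul_add, add_comm]

lemma sum_coeff_zero {ι : Type*} (v : ι → R2) (m : ℤ) (l : List ι)
    (h : ∀ i ∈ l, (v i).coeff m = 0) : ((l.map v).sum).coeff m = 0 := by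
  induction l with
  | nil => rfl
  | cons i l ih =>
    rw [List.map_cons, List.sum_cons, coeff_add', h i (by simp), zero_add]
    exact ih fun j hj => h j (by simp [hj])

lemma list_indep {ι : Type*} (v : ι → R2) (e : ι → ℤ) (h1 : ∀ i, (v i).coeff (e i) = 1)
    (h2 : ∀ i j, j ≠ i → (v j).coeff (e i) = 0) {l : List ι} (hl : l.Nodup)
    (h : (l.map v).sum = 0) : l = [] := by
  cases l with
  | nil => rfl
  | cons i l =>
    exfalso
    have h3 := congrArg (fun p : R2 => p.coeff (e i)) h
    simp only [List.map_cons, List.sum_cons] at h3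
    rw [coeff_add', h1, sum_coeff_zero] at h3
    · exact one_ne_zero h3
    · intro j hj
      apply h2
      rintro rfl
      exact (List.nodup_cons.1 hl).1 hj

/-- Faithfulness on the unipotent part. -/
lemma inj_U {u : FF} (hu : u ∈ UF) (h : IsU u 0 0) : u ∈ NN := by
  have hy : pi u ∈ Subgroup.closure (Set.range fun k : ℤ => pi (Wj gz gx k)) := by
    have : UF ≤ (Subgroup.closure (Set.range fun k : ℤ => pi (Wj gz gx k))).comap pi := by
      rw [UF, Subgroup.closure_le]
      rintro _ ⟨k, rfl⟩
      exact Subgroup.subset_closure ⟨k, rfl⟩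
    exact this hu
  obtain ⟨l, hl, c, hc, e⟩ := normal_form _ DD (fun c hc k => DD_comm_w hc k) w_sq w_comm hy
  obtain ⟨m, hm, c', hc', e'⟩ := normal_form (fun k => pi (dF k)) ⊥
    (by intro c hc i; rw [Subgroup.mem_bot.1 hc]; exact Commute.one_left _)
    (by intro i; exact Subgroup.mem_bot.2 (pi_d i).2.2)
    (by
      intro i j
      refine ⟨1, one_mem _, ?_⟩
      rw [mul_one]
      have hj : Commute (pi (dF i)) (pi (dF j)) := by
        have h1 := (pi_d i).1
        have h2 := (pi_d i).2.1
        cases j with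
        | zero => rw [dF, map_mul]; exact h2.mul_right h2
        | succ j =>
          rw [dF, map_commutatorElement, commutatorElement_def]
          have h3 := commute_zx h1 h2 ((j + 1 : ℕ) : ℤ)
          exact ((h3.mul_right h2).mul_right h3.inv_right).mul_right h2.inv_right
      exact hj) hc
  rw [Subgroup.mem_bot.1 hc', mul_one] at e'
  have e1 : pi u = pi ((l.map fun k => Wj gz gx k).prod * (m.map dF).prod) := by
    rw [e, e', map_mul, map_list_prod, map_list_prod, List.map_map, List.map_map]
    rfl
  obtain ⟨r, hr⟩ := IsU_list_w l
  have hd := IsU_list_d m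
  have h2 := h.congr (hr.mul hd) (pi_eq.1 e1)
  have hl0 : l = [] := by
    refine list_indep (fun k : ℤ => (T (-k) : R2)) (fun k => -k) ?_ ?_ hl ?_
    · intro i
      rw [coeff_T, if_pos rfl]
    · intro i j hij
      rw [coeff_T, if_neg (by omega)]
    · rw [add_zero] at h2
      exact h2.1.symm
  subst hl0
  have hr0 := (hr.unique IsU_one).2
  subst hr0
  have h3 := h2.2
  rw [bar_zero, mul_zero, mul_zero, add_zero, add_zero] at h3
  have hm0 : m = [] := by
    refine list_indep ee (fun k => (k : ℤ)) ?_ ?_ hm ?_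
    · intro i
      rw [coeff_ee, if_pos rfl]
    · intro i j hij
      rw [coeff_ee, if_neg hij]
    · exact (mul_eq_zero.1 h3.symm).resolve_left one_add_ne
  subst hm0
  rw [← pi_eq_one, e1]
  simp

lemma inj_U' {u u' : FF} {p r : R2} (hu : u ∈ UF) (hu' : u' ∈ UF) (h : IsU u p r)
    (h' : IsU u' p r) : u⁻¹ * u' ∈ NN := by
  refine inj_U (mul_mem (inv_mem hu) hu') ?_
  have := h.inv.mul h'
  convert this using 1
  · exact (self_add p).symm
  · have := two_eq
    grind

lemma gx_UF : gx ∈ UF := Subgroup.subset_closure ⟨0, Wj_zero _ _⟩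

lemma UF_conjz {u : FF} (hu : u ∈ UF) : gz⁻¹ * u * gz ∈ UF ∧ gz * u * gz⁻¹ ∈ UF := by
  constructor
  · have : UF ≤ UF.comap (MulAut.conj gz⁻¹).toMonoidHom := by
      conv_lhs => rw [UF]
      rw [Subgroup.closure_le]
      rintro _ ⟨k, rfl⟩
      change MulAut.conj gz⁻¹ (Wj gz gx k) ∈ UF
      rw [MulAut.conj_apply, inv_inv, Wj_conj1]
      exact Subgroup.subset_closure ⟨_, rfl⟩
    have := this hu
    change MulAut.conj gz⁻¹ u ∈ UF at this
    rwa [MulAut.conj_apply, inv_inv] at this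
  · have : UF ≤ UF.comap (MulAut.conj gz).toMonoidHom := by
      conv_lhs => rw [UF]
      rw [Subgroup.closure_le]
      rintro _ ⟨k, rfl⟩
      change MulAut.conj gz (Wj gz gx k) ∈ UF
      have e2 : gz * Wj gz gx k * gz⁻¹ = Wj gz gx (k - 1) := by
        rw [← sub_add_cancel k 1, ← Wj_conj1]
        simp only [add_sub_cancel_right]
        group
      rw [MulAut.conj_apply, e2]
      exact Subgroup.subset_closure ⟨_, rfl⟩
    exact this hu

lemma UF_conjD1 {u : FF} (hu : u ∈ UF) : gD⁻¹ * u * gD ∈ UF ∧ gD * u * gD⁻¹ ∈ UF := by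
  constructor
  · have e : gD⁻¹ * u * gD = gx⁻¹ * (gz⁻¹ * u * gz) * gx := by rw [gD_eq]; group
    rw [e]
    exact mul_mem (mul_mem (inv_mem gx_UF) (UF_conjz hu).1) gx_UF
  · have e : gD * u * gD⁻¹ = gz * (gx * u * gx⁻¹) * gz⁻¹ := by rw [gD_eq]; group
    rw [e]
    exact (UF_conjz (mul_mem (mul_mem gx_UF hu) (inv_mem gx_UF))).2

lemma UF_conjD {u : FF} (hu : u ∈ UF) (k : ℤ) : gD ^ k * u * gD ^ (-k) ∈ UF := by
  induction k using Int.induction_on with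
  | zero => simpa using hu
  | succ n ih =>
    have e : gD ^ ((n : ℤ) + 1) * u * gD ^ (-((n : ℤ) + 1))
        = gD * (gD ^ (n : ℤ) * u * gD ^ (-(n : ℤ))) * gD⁻¹ := by group
    rw [e]
    exact (UF_conjD1 ih).2
  | pred n ih =>
    have e : gD ^ (-(n : ℤ) - 1) * u * gD ^ (-(-(n : ℤ) - 1))
        = gD⁻¹ * (gD ^ (-(n : ℤ)) * u * gD ^ (- -(n : ℤ))) * gD := by group
    rw [e]
    exact (UF_conjD1 ih).1

/-- The stabiliser. -/
def Hs : Subgroup FF := Subgroup.closure {gx, gz} ⊔ NN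

lemma gx_Hs : gx ∈ Hs := Subgroup.mem_sup_left (Subgroup.subset_closure (Or.inl rfl))
lemma gz_Hs : gz ∈ Hs := Subgroup.mem_sup_left (Subgroup.subset_closure (Or.inr rfl))
lemma NN_Hs : NN ≤ Hs := le_sup_right
lemma gD_Hs : gD ∈ Hs := by rw [gD_eq]; exact mul_mem gz_Hs gx_Hs
lemma UF_Hs : UF ≤ Hs := by
  rw [UF, Subgroup.closure_le]
  rintro _ ⟨k, rfl⟩
  exact mul_mem (mul_mem (zpow_mem gz_Hs _) gx_Hs) (zpow_mem gz_Hs _)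

lemma Hs_decomp {h : FF} (hh : h ∈ Hs) : ∃ u ∈ UF, ∃ k : ℤ, ∃ n ∈ NN, h = u * gD ^ k * n := by
  obtain ⟨y, hy, n, hn, rfl⟩ := Subgroup.mem_sup_of_normal_right.1 hh
  have key : ∃ u ∈ UF, ∃ k : ℤ, y = u * gD ^ k := by
    clear hh
    have hxr : ∀ v ∈ UF, ∀ y, (∃ u ∈ UF, ∃ k : ℤ, y = u * gD ^ k) →
        ∃ u ∈ UF, ∃ k : ℤ, y * v = u * gD ^ k := by
      rintro v hv _ ⟨u, hu, k, rfl⟩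
      refine ⟨u * (gD ^ k * v * gD ^ (-k)), mul_mem hu (UF_conjD hv k), k, ?_⟩
      group
    have hDr : ∀ j : ℤ, ∀ y, (∃ u ∈ UF, ∃ k : ℤ, y = u * gD ^ k) →
        ∃ u ∈ UF, ∃ k : ℤ, y * gD ^ j = u * gD ^ k := by
      rintro j _ ⟨u, hu, k, rfl⟩
      exact ⟨u, hu, k + j, by rw [_root_.zpow_add, mul_assoc]⟩
    induction hy using Subgroup.closure_induction_right with
    | one => exact ⟨1, one_mem _, 0, by simp⟩
    | mul_right y _ w hw ih =>
      rcases hw with rfl | hw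
      · exact hxr _ gx_UF _ ih
      · have hw : w = gz := hw
        have e : y * w = y * gD ^ (1 : ℤ) * gx⁻¹ := by rw [hw, gz_eq]; group
        rw [e]
        exact hxr _ (inv_mem gx_UF) _ (hDr 1 _ ih)
    | mul_inv_cancel y _ w hw ih =>
      rcases hw with rfl | hw
      · exact hxr _ (inv_mem gx_UF) _ ih
      · have hw : w = gz := hw
        have e : y * w⁻¹ = y * gx * gD ^ (-1 : ℤ) := by rw [hw, gz_eq]; group
        rw [e]
        exact hDr (-1) _ (hxr _ gx_UF _ ih)
  obtain ⟨u, hu, k, rfl⟩ := key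
  exact ⟨u, hu, k, n, hn, rfl⟩

lemma sc_Hs {h : FF} (hh : h ∈ Hs) : ∃ k : ℤ, ∀ g, sc (g * h) = T k * sc g := by
  obtain ⟨u, hu, k, n, hn, rfl⟩ := Hs_decomp hh
  obtain ⟨p, r, hp⟩ := UF_IsU hu
  obtain ⟨j, hj⟩ := st_N hn
  refine ⟨j + k, fun g => ?_⟩
  have e : g * (u * gD ^ k * n) = g * u * gD ^ k * n := by simp only [mul_assoc]
  rw [e, (hj _).2.2, (st_D _ k).2.2, (st_U hp g).2.2, T_add, mul_assoc]

end Unip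

/-! ### Central states and reductions -/

lemma T_ne (k : ℤ) : (T k : R2) ≠ 0 := (Ex_T k).ne

lemma ebb {b : R2} {s e : ℤ} (h : Ex b s e) : Ex ((1 + T 1) * (b * bar b)) (s - e) (e - s + 1) := by
  have := Ex_one_add.mul (h.mul h.bar)
  have e1 : 0 + (s + -e) = s - e := by ring
  have e2 : 1 + (e + -s) = e - s + 1 := by ring
  rwa [e1, e2] at this

lemma iso_lhs_supp {a c : R2} {la ha lc hc M : ℤ} (h1 : Supp a la ha) (h2 : Supp c lc hc)
    (hM1 : ha - lc ≤ M) (hM2 : 1 - la + hc ≤ M) :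
    ∀ k, M < k → (a * bar c + T 1 * bar a * c).coeff k = 0 := by
  intro k hk
  have a1 := h1.mul h2.bar
  have a2 := (h1.bar.mul h2).T_mul 1
  rw [coeff_add', mul_assoc, a1.zero_of (by omega), a2.zero_of (by omega), add_zero]

lemma iso_bound {g : FF} {la ha lc hc s e M : ℤ} (h1 : Supp (sa g) la ha) (h2 : Supp (sc g) lc hc)
    (h3 : Ex (sb g) s e) (hM1 : ha - lc ≤ M) (hM2 : 1 - la + hc ≤ M) : e - s + 1 ≤ M := by
  by_contra hcon
  have a1 := iso_lhs_supp h1 h2 hM1 hM2 (e - s + 1) (by omega)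
  rw [iso, (ebb h3).2.2] at a1
  exact one_ne_zero a1

def Cen (g : FF) : Prop := ∃ l h, Ex (sc g) l h ∧ Supp (sa g) (l + 1) h

lemma Cen_b {g : FF} {l h : ℤ} (hc : Ex (sc g) l h) (ha : Supp (sa g) (l + 1) h) :
    (Wd (sb g) : ℤ) ≤ h - l := by
  by_cases hb : sb g = 0
  · rw [hb, Wd_zero]
    have := hc.le
    push_cast
    omega
  · obtain ⟨s, e, hE⟩ := exists_Ex hb
    have := iso_bound ha hc.1 hE (M := h - l) (by omega) (by omega)
    rw [hE.Wd_eq]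
    exact this

lemma Cen.ne {g : FF} (h : Cen g) : sc g ≠ 0 := by
  obtain ⟨l, u, h1, h2⟩ := h
  exact h1.ne

lemma Ex_ee (k : ℕ) : Ex (ee k) (-k) k := by
  cases k with
  | zero => simpa [ee] using Ex_one
  | succ k =>
    have h1 := (Ex_T ((k + 1 : ℕ) : ℤ)).1.mono (l' := -((k + 1 : ℕ) : ℤ)) (h' := ((k + 1 : ℕ) : ℤ))
      (by omega) le_rfl
    have h2 := (Ex_T (-((k + 1 : ℕ) : ℤ))).1.mono (l' := -((k + 1 : ℕ) : ℤ))
      (h' := ((k + 1 : ℕ) : ℤ)) le_rfl (by omega)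
    refine ⟨h1.add h2, ?_, ?_⟩
    · rw [ee, coeff_add', coeff_T, coeff_T, if_neg (by omega), if_pos rfl, zero_add]
    · rw [ee, coeff_add', coeff_T, coeff_T, if_pos rfl, if_neg (by omega), add_zero]

lemma dF_UF (k : ℕ) : dF k ∈ UF := by
  cases k with
  | zero => exact mul_mem gx_UF gx_UF
  | succ k =>
    have h1 : Wj gz gx ((k + 1 : ℕ) : ℤ) ∈ UF := Subgroup.subset_closure ⟨_, rfl⟩
    exact mul_mem (mul_mem (mul_mem h1 gx_UF) (inv_mem h1)) (inv_mem gx_UF)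

lemma exist_i (n : ℕ) : ∀ g : FF, Wd (sb g) ≤ n → sc g ≠ 0 →
    ∃ h ∈ Hs, Wd (sb (g * h)) < Wd (sc (g * h)) := by
  induction n with
  | zero =>
    intro g hg hc
    refine ⟨1, one_mem _, ?_⟩
    rw [mul_one]
    have : Wd (sc g) ≠ 0 := fun h => hc (Wd_eq_zero h)
    omega
  | succ n ih =>
    intro g hg hc
    by_cases hlt : Wd (sb g) < Wd (sc g)
    · exact ⟨1, one_mem _, by rwa [mul_one]⟩
    · have hb : sb g ≠ 0 := by
        intro hb
        rw [hb, Wd_zero] at hlt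
        have : Wd (sc g) ≠ 0 := fun h => hc (Wd_eq_zero h)
        omega
      obtain ⟨s, e, hE⟩ := exists_Ex hb
      obtain ⟨l, h, hF⟩ := exists_Ex hc
      have w1 := hE.Wd_eq
      have w2 := hF.Wd_eq
      obtain ⟨d1, d2, d3⟩ := st_D g (s - l)
      obtain ⟨x1, x2, x3⟩ := st_x (g * gD ^ (s - l))
      have hF' := hF.T_mul (s - l)
      have e1 : l + (s - l) = s := by ring
      rw [e1] at hF'
      have hs : Supp (sb (g * gD ^ (s - l) * gx)) (s + 1) e := by
        rw [x2, d2, d3]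
        refine (hE.1.add (hF'.1.mono le_rfl (by omega))).lo ?_
        rw [coeff_add', hE.2.1, hF'.2.1, zmod2_add_self]
      have hw := hs.Wd_le (n := n) (by omega)
      obtain ⟨h', hh', hlt'⟩ := ih _ hw (by rw [x3, d3]; exact mul_ne_zero (T_ne _) hc)
      refine ⟨gD ^ (s - l) * gx * h', mul_mem (mul_mem (zpow_mem gD_Hs _) gx_Hs) hh', ?_⟩
      have e2 : g * (gD ^ (s - l) * gx * h') = g * gD ^ (s - l) * gx * h' := by
        simp only [mul_assoc]
      rwa [e2]

lemma exist_ii (l h : ℤ) (k : ℕ) : ∀ g : FF, Ex (sc g) l h → (Wd (sb g) : ℤ) ≤ h - l →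
    Supp (sa g) (l + 1 - k) (h + k) → ∃ u ∈ Hs, Cen (g * u) := by
  induction k with
  | zero =>
    intro g hc hb ha
    refine ⟨1, one_mem _, l, h, ?_⟩
    rw [mul_one]
    exact ⟨hc, ha.mono (by push_cast; omega) (by push_cast; omega)⟩
  | succ k ih =>
    intro g hc hb ha
    have ha' : Supp (sa g) (l - k) (h + k + 1) := ha.mono (by push_cast; omega) (by push_cast; omega)
    have hab : (sa g).coeff (h + k + 1) + (sa g).coeff (l - k) = 0 := by
      have c1 := ha'.coeff_mul_hi hc.1.bar
      have c2 := ha'.bar.coeff_mul_hi hc.1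
      have hrhs : ((1 + T 1) * (sb g * bar (sb g))).coeff (h + k + 1 - l) = 0 := by
        by_cases hb0 : sb g = 0
        · rw [hb0, zero_mul, mul_zero]; rfl
        · obtain ⟨s, e, hE⟩ := exists_Ex hb0
          have := hE.Wd_eq
          exact (ebb hE).1.zero_of (by omega)
      have e1 : h + k + 1 + -l = h + k + 1 - l := by ring
      have e2 : -(l - k) + h = h + k + 1 - l - 1 := by ring
      rw [coeff_bar, neg_neg, hc.2.1, mul_one, e1] at c1
      rw [coeff_bar, neg_neg, hc.2.2, mul_one, e2] at c2
      rw [← iso, coeff_add', c1, mul_assoc, coeff_T_mul, c2] at hrhs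
      exact hrhs
    rcases zmod2_cases ((sa g).coeff (l - k)) with h0 | h1
    · rw [h0, add_zero] at hab
      refine ih g hc hb ((ha'.lo h0).hi hab |>.mono (by omega) (by omega))
    · have hab' : (sa g).coeff (h + k + 1) = 1 := by
        rcases zmod2_cases ((sa g).coeff (h + k + 1)) with h0 | h0
        · rw [h0, h1, zero_add] at hab; exact absurd hab one_ne_zero
        · exact h0
      obtain ⟨u1, u2, u3⟩ := st_U (IsU_d k) g
      rw [bar_zero, mul_zero, zero_mul, add_zero] at u1
      rw [zero_mul, add_zero] at u2
      have hr := (Ex_one_add.mul (Ex_ee k)).mul hc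
      have e1 : 0 + -(k : ℤ) + l = l - k := by ring
      have e2 : 1 + (k : ℤ) + h = h + k + 1 := by ring
      rw [e1, e2] at hr
      have hs : Supp (sa (g * dF k)) (l - k + 1) (h + k + 1 - 1) := by
        rw [u1]
        refine ((ha'.add hr.1).lo ?_).hi ?_
        · rw [coeff_add', h1, hr.2.1, zmod2_add_self]
        · rw [coeff_add', hab', hr.2.2, zmod2_add_self]
      obtain ⟨v, hv, hcen⟩ := ih (g * dF k) (by rwa [u3]) (by rwa [u2])
        (hs.mono (by omega) (by omega))
      exact ⟨dF k * v, mul_mem (UF_Hs (dF_UF k)) hv, by rwa [← mul_assoc]⟩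

lemma exist_Cen (g : FF) (hc : sc g ≠ 0) : ∃ h ∈ Hs, Cen (g * h) := by
  obtain ⟨h1, hh1, hlt⟩ := exist_i _ g le_rfl hc
  have hc' : sc (g * h1) ≠ 0 := by
    intro h0
    rw [h0, Wd_zero] at hlt
    omega
  obtain ⟨l, h, hE⟩ := exists_Ex hc'
  have hw := hE.Wd_eq
  have : ∃ k : ℕ, Supp (sa (g * h1)) (l + 1 - k) (h + k) := by
    by_cases ha : sa (g * h1) = 0
    · exact ⟨0, by rw [ha]; exact Supp.zero _ _⟩
    · obtain ⟨la, ha', hA⟩ := exists_Ex ha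
      exact ⟨(max (l + 1 - la) (ha' - h)).toNat, hA.1.mono (by omega) (by omega)⟩
  obtain ⟨k, hk⟩ := this
  obtain ⟨u, hu, hcen⟩ := exist_ii l h k _ hE (by omega) hk
  exact ⟨h1 * u, mul_mem hh1 hu, by rwa [← mul_assoc]⟩

/-- The reduction relation. -/
inductive Red : FF → FF ⧸ Hs → Prop
  | base (g : FF) : sc g = 0 → Red g (QuotientGroup.mk g)
  | step (g h : FF) (q : FF ⧸ Hs) : h ∈ Hs → Cen (g * h) → Red (g * h * gf) q → Red g q

lemma mk_mul_Hs (g : FF) {h : FF} (hh : h ∈ Hs) :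
    (QuotientGroup.mk (g * h) : FF ⧸ Hs) = QuotientGroup.mk g :=
  QuotientGroup.mk_mul_of_mem g hh

lemma sc_Hs_zero {g h : FF} (hh : h ∈ Hs) : sc (g * h) = 0 ↔ sc g = 0 := by
  obtain ⟨k, hk⟩ := sc_Hs hh
  rw [hk, mul_eq_zero]
  exact ⟨fun h => h.resolve_left (T_ne k), Or.inr⟩

lemma Red.of_mul {g h : FF} {q : FF ⧸ Hs} (hr : Red (g * h) q) (hh : h ∈ Hs) : Red g q := by
  generalize hg : g * h = g' at hr
  cases hr with
  | base _ h0 =>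
    subst hg
    rw [mk_mul_Hs g hh]
    exact Red.base g ((sc_Hs_zero hh).1 h0)
  | step _ h' _ hh' hcen hr =>
    subst hg
    have e : g * h * h' = g * (h * h') := mul_assoc _ _ _
    rw [e] at hcen hr
    exact Red.step g (h * h') q (mul_mem hh hh') hcen hr

lemma Red.mul {g h : FF} {q : FF ⧸ Hs} (hr : Red g q) (hh : h ∈ Hs) : Red (g * h) q := by
  refine Red.of_mul (h := h⁻¹) ?_ (inv_mem hh)
  rwa [mul_inv_cancel_right]

lemma Red_exists_aux (n : ℕ) : ∀ g : FF, Wd (sc g) ≤ n → ∃ q, Red g q := by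
  induction n with
  | zero =>
    intro g hg
    exact ⟨_, Red.base g (Wd_eq_zero (by omega))⟩
  | succ n ih =>
    intro g hg
    by_cases hc : sc g = 0
    · exact ⟨_, Red.base g hc⟩
    · obtain ⟨h, hh, hcen⟩ := exist_Cen g hc
      obtain ⟨l, u, h1, h2⟩ := hcen
      obtain ⟨k, hk⟩ := sc_Hs hh
      have w1 := h1.Wd_eq
      rw [hk, Wd_T_mul] at w1
      obtain ⟨q, hq⟩ := ih (g * h * gf) (by
        rw [(st_f _).2.2]
        exact h2.Wd_le (by omega))
      exact ⟨q, Red.step g h q hh ⟨l, u, h1, h2⟩ hq⟩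

lemma Red_exists (g : FF) : ∃ q, Red g q := Red_exists_aux _ g le_rfl

def PP (g : FF) : Prop := ∀ q q', Red g q → Red (g * gf) q' → q = q'

lemma PP.unique {g : FF} (h : PP g) {q q' : FF ⧸ Hs} (h1 : Red g q) (h2 : Red g q') : q = q' := by
  obtain ⟨q0, h0⟩ := Red_exists (g * gf)
  rw [h q q0 h1 h0, h q' q0 h2 h0]

lemma gD_gf (j : ℤ) : gD ^ j * gf = gf * gD ^ j := by
  have : Commute gD gf := (Commute.refl gf).mul_left (Commute.refl gf)
  exact (this.zpow_left j)

lemma zp_Hs (j : ℤ) : gD ^ j ∈ Hs := zpow_mem gD_Hs j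

lemma Red_D_f {g : FF} {j : ℤ} {q : FF ⧸ Hs} : Red (g * gD ^ j * gf) q ↔ Red (g * gf) q := by
  rw [mul_assoc, gD_gf, ← mul_assoc]
  exact ⟨fun h => h.of_mul (zp_Hs j), fun h => h.mul (zp_Hs j)⟩

lemma PP_D {g : FF} (j : ℤ) (h : PP (g * gD ^ j)) : PP g := by
  intro q q' h1 h2
  exact h q q' (h1.mul (zp_Hs j)) (Red_D_f.2 h2)

lemma PP_f {g : FF} (h : PP (g * gf)) : PP g := by
  intro q q' h1 h2
  refine (h q' q h2 ?_).symm
  rw [mul_assoc]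
  exact h1.mul gD_Hs

lemma tri1_eq : gf * gx⁻¹ * gf = gx * gf * (gD⁻¹ * gx * (gx⁻¹ * gy ^ 3 * gx)) := by
  simp only [gD, gf]
  group
  rw [zpow_two]

lemma y3_NN : gy ^ 3 ∈ NN := Subgroup.subset_normalClosure (Or.inl (Or.inl rfl))

lemma tri1_mem : gD⁻¹ * gx * (gx⁻¹ * gy ^ 3 * gx) ∈ Hs :=
  mul_mem (mul_mem (inv_mem gD_Hs) gx_Hs)
    (mul_mem (mul_mem (inv_mem gx_Hs) (NN_Hs y3_NN)) gx_Hs)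

lemma PP_tri1 {g : FF} (h1 : PP (g * gx)) (h2 : PP (g * gf * gx⁻¹)) : PP g := by
  intro q q' r1 r2
  obtain ⟨q2, r3⟩ := Red_exists (g * gx * gf)
  have a1 := h1 q q2 (r1.mul gx_Hs) r3
  have a2 := h2 q' q2 (r2.mul (inv_mem gx_Hs)) (by
    have : g * gf * gx⁻¹ * gf = g * gx * gf * (gD⁻¹ * gx * (gx⁻¹ * gy ^ 3 * gx)) := by
      rw [mul_assoc g gf, mul_assoc g, tri1_eq]
      simp only [mul_assoc]
    rw [this]
    exact r3.mul tri1_mem)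
  rw [a1, a2]

lemma tri2_eq : gf⁻¹ * gx * gf = gx⁻¹ * gf * (gx⁻¹ * (gy ^ 3)⁻¹ * gD) := by
  simp only [gD, gf]
  group

lemma tri2_mem : gx⁻¹ * (gy ^ 3)⁻¹ * gD ∈ Hs :=
  mul_mem (mul_mem (inv_mem gx_Hs) (inv_mem (NN_Hs y3_NN))) gD_Hs

lemma tri2_Red {g : FF} {q : FF ⧸ Hs} (h : Red (g * gx⁻¹ * gf) q) :
    Red (g * gf⁻¹ * gx * gf) q := by
  have : g * gf⁻¹ * gx * gf = g * gx⁻¹ * gf * (gx⁻¹ * (gy ^ 3)⁻¹ * gD) := by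
    rw [mul_assoc g gf⁻¹, mul_assoc g, tri2_eq]
    simp only [mul_assoc]
  rw [this]
  exact h.mul tri2_mem

lemma Red_fi {g : FF} {q : FF ⧸ Hs} (h : Red (g * gf) q) : Red (g * gf⁻¹) q := by
  have : g * gf⁻¹ = g * gf * gD⁻¹ := by rw [gD]; group
  rw [this]
  exact h.mul (inv_mem gD_Hs)

lemma PP_tri2 {g : FF} (h1 : PP (g * gx⁻¹)) (h2 : PP (g * gf⁻¹ * gx)) : PP g := by
  intro q q' r1 r2
  obtain ⟨q2, r3⟩ := Red_exists (g * gx⁻¹ * gf)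
  have a1 := h1 q q2 (r1.mul (inv_mem gx_Hs)) r3
  have a2 := h2 q' q2 ((Red_fi r2).mul gx_Hs) (tri2_Red r3)
  rw [a1, a2]

def Bd (g : FF) (n : ℕ) : Prop :=
  2 * Wd (sa g) ≤ n ∧ 2 * Wd (sc g) ≤ n ∧ 2 * Wd (sb g) + 1 ≤ n

lemma case1 {n : ℕ} (IH : ∀ g, Bd g n → PP g) {g : FF} {s e l ha : ℤ} (hn : 2 * (e - s + 1) ≤ n)
    (hA : Ex (sa g) s ha) (hC : Ex (sc g) l e) (hB : Ex (sb g) s e) (hsl : s ≤ l) (hae : ha ≤ e) :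
    PP g := by
  have hse := hB.le
  have hA' : Supp (sa g) s e := hA.1.mono le_rfl hae
  have hC' : Supp (sc g) s e := hC.1.mono hsl le_rfl
  have hTC := (hC'.T_mul 1).mono (l' := s) (h' := e + 1) (by omega) le_rfl
  have hS : Supp (sa g + (1 + T 1) * sb g + T 1 * sc g) (s + 1) e := by
    have h0 := ((hA'.mono (h' := e + 1) le_rfl (by omega)).add hB.1.one_add).add hTC
    have h1 := (h0.lo (by
      rw [coeff_add', coeff_add', coeff_one_add_T_mul, coeff_T_mul, hA.2.1, hB.2.1,
        hB.1.zero_of (by omega), hC'.zero_of (by omega), add_zero, add_zero, zmod2_add_self])).hi (by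
      rw [coeff_add', coeff_add', coeff_one_add_T_mul, coeff_T_mul, hA'.zero_of (by omega),
        hB.1.zero_of (by omega), add_sub_cancel_right, hB.2.2, hC.2.2, zero_add, zero_add,
        zmod2_add_self])
    exact h1.mono le_rfl (by omega)
  have hw := hS.Wd_le (n := (e - s).toNat) (by omega)
  have hwA := hA'.Wd_le (n := (e - s + 1).toNat) (by omega)
  have hwC := hC'.Wd_le (n := (e - s + 1).toNat) (by omega)
  refine PP_tri1 (IH _ ?_) (IH _ ?_)
  · obtain ⟨x1, x2, x3⟩ := st_x g
    rw [Bd, x1, x2, x3]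
    have hb : Supp (sb g + sc g) s (e - 1) := (hB.1.add hC').hi (by
      rw [coeff_add', hB.2.2, hC.2.2, zmod2_add_self])
    have hwb := hb.Wd_le (n := (e - s).toNat) (by omega)
    refine ⟨?_, ?_, ?_⟩ <;> omega
  · obtain ⟨x1, x2, x3⟩ := st_xi (g * gf)
    obtain ⟨f1, f2, f3⟩ := st_f g
    rw [f1, f2, f3] at x1
    rw [f2, f3] at x2
    rw [f3] at x3
    have e1 : T 1 * sc g + (1 + T 1) * sb g + sa g = sa g + (1 + T 1) * sb g + T 1 * sc g := by ring
    rw [Bd, x1, x2, x3, e1]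
    have hb : Supp (sb g + sa g) (s + 1) e := (hB.1.add hA').lo (by
      rw [coeff_add', hB.2.1, hA.2.1, zmod2_add_self])
    have hwb := hb.Wd_le (n := (e - s).toNat) (by omega)
    refine ⟨?_, ?_, ?_⟩ <;> omega

lemma case2 {n : ℕ} (IH : ∀ g, Bd g n → PP g) {g : FF} {s e la h : ℤ} (hn : 2 * (e - s + 1) ≤ n)
    (hA : Ex (sa g) la (e + 1)) (hC : Ex (sc g) s h) (hB : Ex (sb g) s e) (hsl : s < la)
    (hae : h ≤ e) : PP g := by
  have hse := hB.le
  have hA' : Supp (sa g) (s + 1) (e + 1) := hA.1.mono hsl le_rfl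
  have hC' : Supp (sc g) s e := hC.1.mono le_rfl hae
  have hTA := (hA.T_mul (-1))
  rw [add_neg_cancel_right] at hTA
  have hTA' := hTA.1.mono (l' := s) (h' := e) (by omega) le_rfl
  have hS : Supp (sa g + (1 + T 1) * sb g + sc g) (s + 1) e := by
    have h0 := ((hA'.mono (l' := s) (by omega) le_rfl).add hB.1.one_add).add
      (hC'.mono (h' := e + 1) le_rfl (by omega))
    have h1 := (h0.lo (by
      rw [coeff_add', coeff_add', coeff_one_add_T_mul, hA'.zero_of (by omega), hB.2.1,
        hB.1.zero_of (by omega), hC.2.1, add_zero, zero_add, zmod2_add_self])).hi (by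
      rw [coeff_add', coeff_add', coeff_one_add_T_mul, hA.2.2,
        hB.1.zero_of (by omega), add_sub_cancel_right, hB.2.2, hC'.zero_of (by omega), zero_add,
        add_zero, zmod2_add_self])
    exact h1.mono le_rfl (by omega)
  have hw := hS.Wd_le (n := (e - s).toNat) (by omega)
  have hwA := hTA'.Wd_le (n := (e - s + 1).toNat) (by omega)
  have hwC := hC'.Wd_le (n := (e - s + 1).toNat) (by omega)
  refine PP_tri2 (IH _ ?_) (IH _ ?_)
  · obtain ⟨x1, x2, x3⟩ := st_xi g
    rw [Bd, x1, x2, x3]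
    have hb : Supp (sb g + sc g) (s + 1) e := (hB.1.add hC').lo (by
      rw [coeff_add', hB.2.1, hC.2.1, zmod2_add_self])
    have hwb := hb.Wd_le (n := (e - s).toNat) (by omega)
    refine ⟨?_, ?_, ?_⟩ <;> omega
  · obtain ⟨x1, x2, x3⟩ := st_x (g * gf⁻¹)
    obtain ⟨f1, f2, f3⟩ := st_fi g
    rw [f1, f2, f3] at x1
    rw [f2, f3] at x2
    rw [f3] at x3
    have e1 : sc g + (1 + T 1) * sb g + T 1 * (T (-1) * sa g)
        = sa g + (1 + T 1) * sb g + sc g := by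
      rw [← mul_assoc (T 1), TT]
      ring
    rw [Bd, x1, x2, x3, e1]
    have hb : Supp (sb g + T (-1) * sa g) s (e - 1) := (hB.1.add hTA').hi (by
      rw [coeff_add', hB.2.2, hTA.2.2, zmod2_add_self])
    have hwb := hb.Wd_le (n := (e - s).toNat) (by omega)
    refine ⟨?_, ?_, ?_⟩ <;> omega

lemma Red_zero {g : FF} (h0 : sc g = 0) {q : FF ⧸ Hs} (h : Red g q) : q = QuotientGroup.mk g := by
  cases h with
  | base _ _ => rfl
  | step _ h _ hh hcen _ =>
    exact absurd ((sc_Hs_zero hh).2 h0) hcen.ne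

/-- uniqueness of reductions for small width -/
lemma small_unique {n : ℕ} (IH : ∀ g, Bd g n → PP g) {g : FF} (hn : 2 * Wd (sc g) ≤ n)
    {q q' : FF ⧸ Hs} (h1 : Red g q) (h2 : Red g q') : q = q' := by
  by_cases h0 : sc g = 0
  · rw [Red_zero h0 h1, Red_zero h0 h2]
  · obtain ⟨h, hh, hcen⟩ := exist_Cen g h0
    obtain ⟨l, u, hc, ha⟩ := hcen
    obtain ⟨k, hk⟩ := sc_Hs hh
    have w1 := hc.Wd_eq
    have w2 := Cen_b hc ha
    have w3 := hc.le
    have w4 := ha.Wd_le (n := (u - l).toNat) (by omega)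
    have w5 : Wd (sc (g * h)) = Wd (sc g) := by rw [hk, Wd_T_mul]
    have : PP (g * h) := IH _ ⟨by omega, by omega, by omega⟩
    exact this.unique (h1.mul hh) (h2.mul hh)

lemma chain {n : ℕ} (IH : ∀ g, Bd g n → PP g) (l h M : ℤ) (hn : 2 * (h - l) + 1 ≤ n) (k : ℕ) :
    ∀ g, Ex (sc g) l h → Supp (sa g) (l + 1) h → Supp (sb g) (M - k) (M + (h - l) - 1) →
    ∃ u ∈ UF, Supp (sa (g * u)) (l + 1) h ∧ Supp (sb (g * u)) M (M + (h - l) - 1) ∧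
      ∀ q q', Red (g * gf) q → Red (g * u * gf) q' → q = q' := by
  induction k with
  | zero =>
    intro g hc ha hb
    refine ⟨1, one_mem _, ?_⟩
    rw [mul_one]
    refine ⟨ha, by simpa using hb, ?_⟩
    intro q q' h1 h2
    refine small_unique IH ?_ h1 h2
    rw [(st_f g).2.2]
    have := hc.le
    have := ha.Wd_le (n := (h - l).toNat) (by omega)
    omega
  | succ k ih =>
    intro g hc ha hb
    obtain ⟨s, hs⟩ : ∃ s, s = M - ((k + 1 : ℕ) : ℤ) := ⟨_, rfl⟩
    rw [← hs] at hb
    push_cast at hs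
    rcases zmod2_cases ((sb g).coeff s) with h0 | h1
    · exact ih g hc ha ((hb.lo h0).mono (by omega) le_rfl)
    · have hb0 : sb g ≠ 0 := by
        intro hb0
        rw [hb0] at h1
        exact zero_ne_one h1
      obtain ⟨s', e, hE⟩ := exists_Ex hb0
      have hw := Cen_b hc ha
      rw [hE.Wd_eq] at hw
      have hs' : s' = s := by
        have a1 := hE.1 s (by rw [h1]; exact one_ne_zero)
        have a2 := hb s' (by rw [hE.2.1]; exact one_ne_zero)
        omega
      subst hs'
      have hse := hE.le
      have hb' : Supp (sb g) s' (s' + (h - l) - 1) := hE.1.mono le_rfl (by omega)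
      obtain ⟨d1, d2, d3⟩ := st_D g (s' - l)
      have hTc := hc.T_mul (s' - l)
      have hTa := ha.T_mul (s' - l)
      have e1 : l + (s' - l) = s' := by ring
      have e2 : h + (s' - l) = s' + (h - l) := by ring
      have e3 : l + 1 + (s' - l) = s' + 1 := by ring
      rw [e1, e2, ← d3] at hTc
      rw [e3, e2, ← d1] at hTa
      rw [← d2] at hb' h1
      have hIH : ∃ g1, g1 = g * gD ^ (s' - l) := ⟨_, rfl⟩
      obtain ⟨g1, hg1⟩ := hIH
      rw [← hg1] at hTc hTa hb' h1
      have hS : Supp (sa g1 + (1 + T 1) * sb g1 + sc g1) (s' + 1) (s' + (h - l)) := by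
        have a1 := hb'.one_add
        rw [sub_add_cancel] at a1
        refine (((hTa.mono (l' := s') (by omega) le_rfl).add a1).add hTc.1).lo ?_
        rw [coeff_add', coeff_add', coeff_one_add_T_mul, hTa.zero_of (by omega), h1,
          hb'.zero_of (by omega), hTc.2.1, add_zero, zero_add, zmod2_add_self]
      have hSb : Supp (sb g1 + sc g1) (s' + 1) (s' + (h - l)) := by
        refine ((hb'.mono (h' := s' + (h - l)) le_rfl (by omega)).add hTc.1).lo ?_
        rw [coeff_add', h1, hTc.2.1, zmod2_add_self]
      obtain ⟨x1, x2, x3⟩ := st_xi g1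
      obtain ⟨y1, y2, y3⟩ := st_D (g1 * gx⁻¹) (-(s' - l))
      have hu1 : gD ^ (s' - l) * gx⁻¹ * gD ^ (-(s' - l)) ∈ UF := UF_conjD (inv_mem gx_UF) _
      have eg : g * (gD ^ (s' - l) * gx⁻¹ * gD ^ (-(s' - l))) = g1 * gx⁻¹ * gD ^ (-(s' - l)) := by
        rw [hg1]; simp only [mul_assoc]
      rw [x1] at y1
      rw [x2] at y2
      rw [x3] at y3
      have hc2 : Ex (sc (g1 * gx⁻¹ * gD ^ (-(s' - l)))) l h := by
        rw [y3]
        have := hTc.T_mul (-(s' - l))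
        have z1 : s' + -(s' - l) = l := by ring
        have z2 : s' + (h - l) + -(s' - l) = h := by ring
        rwa [z1, z2] at this
      have ha2 : Supp (sa (g1 * gx⁻¹ * gD ^ (-(s' - l)))) (l + 1) h := by
        rw [y1]
        exact (hS.T_mul (-(s' - l))).mono (by omega) (by omega)
      obtain ⟨u, hu, v1, v2, v3⟩ := ih _ hc2 ha2 (by
        rw [y2]
        exact hSb.mono (by omega) (by omega))
      refine ⟨gD ^ (s' - l) * gx⁻¹ * gD ^ (-(s' - l)) * u, mul_mem hu1 hu, ?_⟩
      rw [← mul_assoc g, eg]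
      refine ⟨v1, v2, ?_⟩
      intro q q' r1 r2
      obtain ⟨q1, r3⟩ := Red_exists (g1 * gx⁻¹ * gD ^ (-(s' - l)) * gf)
      rw [← v3 q1 q' r3 r2]
      have r4 := tri2_Red (Red_D_f.1 r3)
      have r5 : Red (g1 * gf⁻¹ * gx) q := by
        refine Red.mul (Red_fi ?_) gx_Hs
        rw [hg1]
        exact Red_D_f.2 r1
      refine IH (g1 * gf⁻¹ * gx) ?_ q q1 r5 r4
      obtain ⟨x1, x2, x3⟩ := st_x (g1 * gf⁻¹)
      obtain ⟨f1, f2, f3⟩ := st_fi g1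
      rw [f1, f2, f3] at x1
      rw [f2, f3] at x2
      rw [f3] at x3
      have ee1 : sc g1 + (1 + T 1) * sb g1 + T 1 * (T (-1) * sa g1)
          = sa g1 + (1 + T 1) * sb g1 + sc g1 := by
        rw [← mul_assoc (T 1), TT]
        ring
      rw [Bd, x1, x2, x3, ee1]
      have hTTa := hTa.T_mul (-1)
      rw [add_neg_cancel_right] at hTTa
      have w1 := hS.Wd_le (n := (h - l).toNat) (by omega)
      have w2 := hTTa.Wd_le (n := (h - l).toNat) (by omega)
      have w3 := (hb'.add (hTTa.mono le_rfl (by omega))).Wd_le (n := (h - l).toNat) (by omega)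
      refine ⟨?_, ?_, ?_⟩ <;> omega

lemma eq_zero_of_window {p c : R2} {l h M : ℤ} (hc : Ex c l h)
    (hs : Supp (p * c) M (M + (h - l) - 1)) : p = 0 := by
  by_contra hp
  obtain ⟨s, e, hE⟩ := exists_Ex hp
  have h1 := hE.mul hc
  have h2 := hE.le
  have a1 := hs _ (by rw [h1.2.1]; exact one_ne_zero)
  have a2 := hs _ (by rw [h1.2.2]; exact one_ne_zero)
  omega

lemma exists_supp (p : R2) : ∃ l h, Supp p l h := by
  obtain ⟨l, hl⟩ := exists_supp_Wd p
  exact ⟨_, _, hl⟩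

lemma case3 {n : ℕ} (IH : ∀ g, Bd g n → PP g) {g : FF} {l h : ℤ} (hn : 2 * (h - l) + 1 ≤ n)
    (hc : Ex (sc g) l h) (ha : Supp (sa g) (l + 1) h) : PP g := by
  intro q q' r1 r2
  cases r1 with
  | base _ h0 => exact absurd h0 hc.ne
  | step _ h' _ hh hcen r1 =>
    obtain ⟨u, hu, k, m, hm, rfl⟩ := Hs_decomp hh
    obtain ⟨p, r, hpr⟩ := UF_IsU hu
    obtain ⟨x1, x2, x3⟩ := st_U hpr g
    have r3 : Red (g * u * gf) q := by
      have e1 : g * (u * gD ^ k * m) * gf = g * u * gD ^ k * gf * (gf⁻¹ * m * gf) := by group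
      rw [e1] at r1
      have hm' : gf⁻¹ * m * gf ∈ NN := by
        have := (inferInstance : NN.Normal).conj_mem m hm gf⁻¹
        rwa [inv_inv] at this
      exact Red_D_f.1 (r1.of_mul (NN_Hs hm'))
    have ha' : Supp (sa (g * u)) (l + 1) h := by
      obtain ⟨l', h'', hc', ha'⟩ := hcen
      have e1 : g * (u * gD ^ k * m) = g * u * gD ^ k * m := by simp only [mul_assoc]
      obtain ⟨j, hj⟩ := st_N hm
      obtain ⟨y1, y2, y3⟩ := hj (g * u * gD ^ k)
      obtain ⟨z1, z2, z3⟩ := st_D (g * u) k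
      rw [e1, y3, z3, x3, ← mul_assoc, ← T_add] at hc'
      rw [e1, y1, z1, ← mul_assoc, ← T_add] at ha'
      have h1 := (hc.T_mul (j + k)).unique hc'
      have h2 := ha'.T_mul (-(j + k))
      rw [← mul_assoc, ← T_add, neg_add_cancel, T_zero, one_mul] at h2
      exact h2.mono (by omega) (by omega)
    have hc' : Ex (sc (g * u)) l h := by rwa [x3]
    obtain ⟨s1, e1, b1⟩ := exists_supp (sb g)
    obtain ⟨s2, e2, b2⟩ := exists_supp (sb (g * u))
    obtain ⟨M, hM⟩ : ∃ M, M = max e1 e2 - (h - l) + 1 := ⟨_, rfl⟩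
    obtain ⟨u1, hu1, v1, v2, v3⟩ := chain IH l h M hn (M - s1).toNat g hc ha
      (b1.mono (by omega) (by omega))
    obtain ⟨u2, hu2, t1, t2, t3⟩ := chain IH l h M hn (M - s2).toNat (g * u) hc' ha'
      (b2.mono (by omega) (by omega))
    obtain ⟨p1, ρ1, i1⟩ := UF_IsU hu1
    obtain ⟨p2, ρ2, i2⟩ := UF_IsU (mul_mem hu hu2)
    rw [mul_assoc] at t1 t2
    obtain ⟨m1, m2, m3⟩ := st_U i1 g
    obtain ⟨n1, n2, n3⟩ := st_U i2 g
    have htwo := two_eq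
    have hp : p1 + p2 = 0 := by
      refine eq_zero_of_window (M := M) hc ?_
      have := v2.add t2
      rw [m2, n2] at this
      have e : sb g + p1 * sc g + (sb g + p2 * sc g) = (p1 + p2) * sc g := by grind
      rwa [e] at this
    have hp' : p1 = p2 := by grind
    subst hp'
    have hr : ρ1 + ρ2 = 0 := by
      refine eq_zero_of_window (M := l + 1) hc ?_
      have := v1.add t1
      rw [m1, n1] at this
      have e : sa g + (1 + T 1) * bar p1 * sb g + ρ1 * sc g
        + (sa g + (1 + T 1) * bar p1 * sb g + ρ2 * sc g) = (ρ1 + ρ2) * sc g := by grind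
      rw [e] at this
      exact this.mono le_rfl (by omega)
    have hr' : ρ1 = ρ2 := by grind
    subst hr'
    have hN := inj_U' hu1 (mul_mem hu hu2) i1 i2
    obtain ⟨q1, w1⟩ := Red_exists (g * u1 * gf)
    have a1 := v3 q' q1 r2 w1
    have a2 := t3 q q1 r3 (by
      have e : g * u * u2 * gf = g * u1 * gf * (gf⁻¹ * (u1⁻¹ * (u * u2)) * gf) := by group
      rw [e]
      have hm' : gf⁻¹ * (u1⁻¹ * (u * u2)) * gf ∈ NN := by
        have := (inferInstance : NN.Normal).conj_mem _ hN gf⁻¹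
        rwa [inv_inv] at this
      exact w1.mul (NN_Hs hm'))
    rw [a1, a2]

lemma main_step {n : ℕ} (IH : ∀ g, Bd g n → PP g) {g : FF} (hB : Bd g (n + 1))
    (hac : Wd (sa g) ≤ Wd (sc g)) : PP g := by
  obtain ⟨b1, b2, b3⟩ := hB
  have hc0 : sc g ≠ 0 := by
    intro h0
    rw [h0, Wd_zero] at hac
    exact sc_ne_of_sa (Wd_eq_zero (by omega)) h0
  obtain ⟨l, h, hC⟩ := exists_Ex hc0
  have wC := hC.Wd_eq
  by_cases ha0 : sa g = 0
  · refine case3 IH (by omega) hC ?_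
    rw [ha0]
    exact Supp.zero _ _
  obtain ⟨la, ha, hA⟩ := exists_Ex ha0
  have wA := hA.Wd_eq
  have lA := hA.le
  have lC := hC.le
  have c1 := (hA.mul hC.bar)
  have c2 := (hA.bar.mul hC).T_mul 1
  have hiso := iso g
  rw [mul_assoc] at hiso
  by_cases h1 : la ≤ l
  · have htop : ((1 + T 1) * (sb g * bar (sb g))).coeff (-la + h + 1) = 1 := by
      rw [← hiso, coeff_add', c1.1.zero_of (by omega), c2.2.2, zero_add]
    have hb0 : sb g ≠ 0 := by
      intro h0
      rw [h0, zero_mul, mul_zero] at htop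
      exact zero_ne_one htop
    obtain ⟨s, e, hE⟩ := exists_Ex hb0
    have a1 := iso_bound hA.1 hC.1 hE (M := h - la + 1) (by omega) (by omega)
    have a2 := (ebb hE).1 _ (by rw [htop]; exact one_ne_zero)
    have wB := hE.Wd_eq
    refine PP_D (s - la) ?_
    obtain ⟨d1, d2, d3⟩ := st_D g (s - la)
    have hA' := hA.T_mul (s - la)
    have hC' := hC.T_mul (s - la)
    rw [← d1, show la + (s - la) = s by ring] at hA'
    rw [← d3, show h + (s - la) = e by omega] at hC'
    rw [← d2] at hE
    exact case1 IH (by omega) hA' hC' hE (by omega) (by omega)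
  · by_cases h2 : ha ≤ h
    · exact case3 IH (by omega) hC (hA.1.mono (by omega) h2)
    · have htop : ((1 + T 1) * (sb g * bar (sb g))).coeff (ha + -l) = 1 := by
        rw [← hiso, coeff_add', c2.1.zero_of (by omega), c1.2.2, add_zero]
      have hb0 : sb g ≠ 0 := by
        intro h0
        rw [h0, zero_mul, mul_zero] at htop
        exact zero_ne_one htop
      obtain ⟨s, e, hE⟩ := exists_Ex hb0
      have a1 := iso_bound hA.1 hC.1 hE (M := ha - l) (by omega) (by omega)
      have a2 := (ebb hE).1 _ (by rw [htop]; exact one_ne_zero)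
      have wB := hE.Wd_eq
      refine PP_D (s - l) ?_
      obtain ⟨d1, d2, d3⟩ := st_D g (s - l)
      have hA' := hA.T_mul (s - l)
      have hC' := hC.T_mul (s - l)
      rw [← d1, show ha + (s - l) = e + 1 by omega] at hA'
      rw [← d3, show l + (s - l) = s by ring] at hC'
      rw [← d2] at hE
      exact case2 IH (by omega) hA' hC' hE (by omega) (by omega)

lemma PP_all_aux (n : ℕ) : ∀ g, Bd g n → PP g := by
  induction n with
  | zero =>
    intro g hg
    have := hg.2.2
    omega
  | succ n IH =>
    intro g hg
    by_cases h : Wd (sa g) ≤ Wd (sc g)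
    · exact main_step IH hg h
    · refine PP_f (main_step IH ?_ ?_)
      · obtain ⟨f1, f2, f3⟩ := st_f g
        rw [Bd, f1, f2, f3, Wd_T_mul]
        exact ⟨hg.2.1, hg.1, hg.2.2⟩
      · obtain ⟨f1, f2, f3⟩ := st_f g
        rw [f1, f3, Wd_T_mul]
        omega

lemma PP_all (g : FF) : PP g :=
  PP_all_aux (2 * Wd (sa g) + 2 * Wd (sc g) + 2 * Wd (sb g) + 1) g ⟨by omega, by omega, by omega⟩

lemma Red_all (g : FF) : ∀ q, Red g q → q = QuotientGroup.mk 1 := by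
  induction g using ff_induct with
  | h1 => intro q hq; exact Red_zero st_one.2.2 hq
  | hx g ih => intro q hq; exact ih q (hq.of_mul gx_Hs)
  | hxi g ih => intro q hq; exact ih q (hq.of_mul (inv_mem gx_Hs))
  | hf g ih =>
    intro q hq
    obtain ⟨q0, h0⟩ := Red_exists g
    rw [← PP_all g q0 q h0 hq]
    exact ih q0 h0
  | hfi g ih =>
    intro q hq
    obtain ⟨q0, h0⟩ := Red_exists g
    have := PP_all (g * gf⁻¹) q q0 hq (by rwa [inv_mul_cancel_right])
    rw [this]
    exact ih q0 h0

lemma mem_Hs {g : FF} (h : sc g = 0) : g ∈ Hs := by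
  have := Red_all g _ (Red.base g h)
  have h2 := QuotientGroup.eq.1 this
  rw [mul_one] at h2
  exact inv_mem_iff.1 h2

lemma ker_le {g : FF} {r : R2} (h : (rho g).val = Matrix.scalar (Fin 3) r) : g ∈ NN := by
  have h0 : sc g = 0 := by
    rw [sc, h]
    simp
  obtain ⟨u, hu, k, n, hn, rfl⟩ := Hs_decomp (mem_Hs h0)
  refine mul_mem ?_ hn
  obtain ⟨j, hj⟩ := NN_T (inv_mem hn)
  have h1 : (rho (u * gD ^ k)).val = Matrix.scalar (Fin 3) (r * T j) := by
    have : u * gD ^ k = u * gD ^ k * n * n⁻¹ := by group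
    rw [this, rho_mul, h, hj, ← map_mul]
  obtain ⟨p, ρ, hp⟩ := UF_IsU hu
  rw [rho_mul, hp, rho_Dz, UM, Matrix.mul_fin_three] at h1
  have e00 := congrFun (congrFun h1 0) 0
  have e01 := congrFun (congrFun h1 0) 1
  have e02 := congrFun (congrFun h1 0) 2
  have e11 := congrFun (congrFun h1 1) 1
  simp at e00 e01 e02 e11
  rw [← e11] at e00
  have hk : k = 0 := by
    have := Ex_T k
    rw [e00] at this
    exact (this.unique Ex_one).1
  subst hk
  have hr0 : ρ = 0 := by
    rcases e02 with h | h
    · exact h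
    · exact absurd h (T_ne _)
  subst e01
  subst hr0
  rw [_root_.zpow_zero, mul_one]
  exact inj_U hu hp

/-- **Lemma 2.2.** `Q_{4,2}` is presented by generators `x, y` with relations `y³ = 1`,
`x_i⁴ = 1` and `[x_i², yxy] = 1` for all `i ≥ 0`: the homomorphism from the free group on
`x, y` sending `x ↦ p(X)`, `y ↦ p(Y)` has range `Q_{4,2}` and kernel the normal closure
of the relators. -/
theorem statement4 :
    (FreeGroup.lift ![pp X, pp Y]).range = Q42 ∧
      (FreeGroup.lift ![pp X, pp Y]).ker = Subgroup.normalClosure q42Rels := by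
  refine ⟨?_, le_antisymm ?_ NN_le⟩
  · rw [FreeGroup.range_lift_eq_closure]
    congr 1
    ext z
    simp [or_comm]
  · intro g hg
    rw [MonoidHom.mem_ker, lift_eq, pp_eq_one_iff] at hg
    obtain ⟨r, hr⟩ := hg
    exact ker_le hr
end
end

section
/- Regard X and Y as elements of GL(3, 𝔽₂(t)) via the inclusion 𝔽₂[t,t⁻¹] ⊆ 𝔽₂(t). For every rational function f ∈ 𝔽₂(t), the 3×3 matrix M_f over 𝔽₂(t) with rows (f, f+1+t, f+1+t), (t³/(1+t)², t/(1+t)², t³/(1+t)²), ((f(1+t²)+(t+t²+t³))/(1+t)², (f(1+t²)+(1+t+t³))/(1+t)², (f(1+t²)+1)/(1+t)²) has determinant t² (in particular M_f is invertible), and satisfies M_f · X · M_f⁻¹ = t·[YXY, X] and M_f · (YXY) · M_f⁻¹ = YXY, where YXY denotes the matrix product Y·X·Y. -/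
open Matrix

noncomputable section

set_option synthInstance.maxHeartbeats 1000000
set_option maxHeartbeats 1000000

/-- The field `𝔽₂(t)` of rational functions over the field with two elements. -/
abbrev K2 : Type := RatFunc (ZMod 2)

/-- The rational function `t`. -/
def tK : K2 := RatFunc.X

/-- The matrix `X = t·!![0,0,1; 1,0,1; 0,1,1]` over `𝔽₂(t)`. -/
def XK : Matrix (Fin 3) (Fin 3) K2 := tK • (!![0,0,1; 1,0,1; 0,1,1] : Matrix (Fin 3) (Fin 3) K2)

/-- The matrix `Y = t·!![0,0,1; t,1,1; 0,1,1]` over `𝔽₂(t)`. -/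
def YK : Matrix (Fin 3) (Fin 3) K2 := tK • (!![0,0,1; tK,1,1; 0,1,1] : Matrix (Fin 3) (Fin 3) K2)

/-- The matrix `M_f` of Remark 2.6, for a rational function `f ∈ 𝔽₂(t)`. -/
def Mf (f : K2) : Matrix (Fin 3) (Fin 3) K2 :=
  !![f, f + 1 + tK, f + 1 + tK;
     tK ^ 3 / (1 + tK) ^ 2, tK / (1 + tK) ^ 2, tK ^ 3 / (1 + tK) ^ 2;
     (f * (1 + tK ^ 2) + (tK + tK ^ 2 + tK ^ 3)) / (1 + tK) ^ 2,
       (f * (1 + tK ^ 2) + (1 + tK + tK ^ 3)) / (1 + tK) ^ 2,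
       (f * (1 + tK ^ 2) + 1) / (1 + tK) ^ 2]

section gen
variable {K : Type*} [Field K]

def gX (t : K) : Matrix (Fin 3) (Fin 3) K := t • !![0,0,1; 1,0,1; 0,1,1]
def gY (t : K) : Matrix (Fin 3) (Fin 3) K := t • !![0,0,1; t,1,1; 0,1,1]
def gM (t f : K) : Matrix (Fin 3) (Fin 3) K :=
  !![f, f + 1 + t, f + 1 + t;
     t ^ 3 / (1 + t) ^ 2, t / (1 + t) ^ 2, t ^ 3 / (1 + t) ^ 2;
     (f * (1 + t ^ 2) + (t + t ^ 2 + t ^ 3)) / (1 + t) ^ 2,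
       (f * (1 + t ^ 2) + (1 + t + t ^ 3)) / (1 + t) ^ 2,
       (f * (1 + t ^ 2) + 1) / (1 + t) ^ 2]

theorem gM_det [CharP K 2] (t f : K) (h : 1 + t ≠ 0) : (gM t f).det = t ^ 2 := by
  have h2 : (2 : K) = 0 := CharTwo.two_eq_zero
  simp only [gM, Matrix.det_fin_three]
  simp
  field_simp
  grind

theorem gX_det (t : K) (h : t ≠ 0) : (gX t).det ≠ 0 := by
  simp [gX, Matrix.det_fin_three, h]

theorem gY_det [CharP K 2] (t : K) (h : t ≠ 0) : (gY t).det ≠ 0 := by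
  have h2 : (2 : K) = 0 := CharTwo.two_eq_zero
  simp [gY, Matrix.det_fin_three, h]

theorem g1 [CharP K 2] (t f : K) (h : 1 + t ≠ 0) :
    gX t * (gY t * gX t * gY t) * gM t f * gX t =
      t • ((gY t * gX t * gY t) * gX t * gM t f) := by
  have h2 : (2 : K) = 0 := CharTwo.two_eq_zero
  ext i j
  fin_cases i <;> fin_cases j <;>
    simp [gX, gY, gM, Matrix.mul_apply, Fin.sum_univ_three] <;> field_simp <;> grind

theorem g2 [CharP K 2] (t f : K) (h : 1 + t ≠ 0) :
    gM t f * (gY t * gX t * gY t) = (gY t * gX t * gY t) * gM t f := by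
  have h2 : (2 : K) = 0 := CharTwo.two_eq_zero
  ext i j
  fin_cases i <;> fin_cases j <;>
    simp [gX, gY, gM, Matrix.mul_apply, Fin.sum_univ_three] <;> field_simp <;> grind

theorem g_all [CharP K 2] (t f : K) (ht : t ≠ 0) (h : 1 + t ≠ 0) :
    (gM t f).det = t ^ 2 ∧ IsUnit (gM t f) ∧
      gM t f * gX t * (gM t f)⁻¹ =
        t • ((gY t * gX t * gY t)⁻¹ * (gX t)⁻¹ * (gY t * gX t * gY t) * gX t) ∧
      gM t f * (gY t * gX t * gY t) * (gM t f)⁻¹ = gY t * gX t * gY t := by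
  have hd := gM_det t f h
  have hM : IsUnit (gM t f).det := by rw [hd]; exact (pow_ne_zero 2 ht).isUnit
  have hX : IsUnit (gX t).det := (gX_det t ht).isUnit
  have hY : IsUnit (gY t).det := (gY_det t ht).isUnit
  have hW : IsUnit (gY t * gX t * gY t).det := by
    rw [Matrix.det_mul, Matrix.det_mul]; exact (hY.mul hX).mul hY
  have e1 := g1 t f h
  have e2 := g2 t f h
  generalize gY t * gX t * gY t = W at *
  generalize gX t = A at *
  generalize gM t f = M at *
  refine ⟨hd, (Matrix.isUnit_iff_isUnit_det _).2 hM, ?_, ?_⟩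
  · have e3 : M * A = t • (W⁻¹ * A⁻¹ * W * A) * M := by
      calc M * A = W⁻¹ * (A⁻¹ * (A * W * M * A)) := by
            rw [Matrix.mul_assoc A, Matrix.mul_assoc A, Matrix.nonsing_inv_mul_cancel_left _ _ hX,
              Matrix.mul_assoc W, Matrix.nonsing_inv_mul_cancel_left _ _ hW]
        _ = _ := by rw [e1]; simp [Matrix.mul_assoc]
    rw [e3, Matrix.mul_nonsing_inv_cancel_right _ _ hM]
  · rw [e2, Matrix.mul_nonsing_inv_cancel_right _ _ hM]

end gen

theorem tK_ne : tK ≠ 0 := RatFunc.X_ne_zero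

theorem one_add_tK_ne : 1 + tK ≠ 0 := by
  intro h
  have h1 : algebraMap (Polynomial (ZMod 2)) K2 (Polynomial.X + Polynomial.C 1) = 0 := by
    rw [map_add, RatFunc.algebraMap_X, Polynomial.C_1, map_one, add_comm]; exact h
  exact Polynomial.X_add_C_ne_zero (1 : ZMod 2) ((map_eq_zero_iff _ (RatFunc.algebraMap_injective (ZMod 2))).1 h1)

/-- **Remark 2.6.** For every `f ∈ 𝔽₂(t)`, the matrix `M_f` has determinant `t²` (in
particular it is invertible) and satisfies `M_f·X·M_f⁻¹ = t·[YXY, X]` and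
`M_f·(YXY)·M_f⁻¹ = YXY`, where `[A,B] = A⁻¹B⁻¹AB`. -/
theorem statement6 (f : K2) :
    (Mf f).det = tK ^ 2 ∧ IsUnit (Mf f) ∧
      Mf f * XK * (Mf f)⁻¹ =
        tK • (((YK * XK * YK)⁻¹ * XK⁻¹ * (YK * XK * YK) * XK) : Matrix (Fin 3) (Fin 3) K2) ∧
      Mf f * (YK * XK * YK) * (Mf f)⁻¹ = YK * XK * YK := by
  have : CharP K2 2 := charP_of_injective_algebraMap (algebraMap (ZMod 2) K2).injective 2
  exact g_all tK f tK_ne one_add_tK_ne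
end
end
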